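/- arXiv:2009.10120 — 4 statements merged into one kernel-verified Lean document; each statement's English description precedes it below -/
import Mathlib

section
/- Let A be a ring, f : X → Y a map of nonnegatively graded chain complexes of A-modules, P a projective A-module, n a natural number, and k : P → H_n(cone f) a surjective A-linear map. Then there exist a nonnegatively graded chain complex X′ with X′_q = X_q for q ≠ n and X′_n = X_n ⊕ P, a chain map i : X → X′ which in each degree is the canonical inclusion, and a chain map g : X′ → Y with g ∘ i = f, such that: (1) H_q(cone i) = 0 for q ≠ n and H_n(cone i) ≅ P; (2) H_n(cone g) = 0; (3) H_q(cone g) ≅ H_q(cone f) for all q ∉ {n, n+1}; and (4) there is a short exact sequence 0 → H_{n+1}(cone f) → H_{n+1}(cone g) → ker k → 0. -/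
open CategoryTheory Limits

universe u

instance instDecRelDownInt : DecidableRel (ComplexShape.down ℤ).Rel :=
  fun a b => inferInstanceAs (Decidable (b + 1 = a))

instance instHasCofiber {A : Type u} [Ring A] {X Y : ChainComplex (ModuleCat.{u} A) ℤ}
    (f : X ⟶ Y) : HomologicalComplex.HasHomotopyCofiber f :=
  @HomologicalComplex.instHasHomotopyCofiberOfHasBinaryBiproducts _ _ _ _ _ _ _ _ inferInstance

/-- The mapping cone of a chain map: in degree `q` it is `Y_q ⊕ X_{q−1}`. -/
noncomputable def Cone {A : Type u} [Ring A] {X Y : ChainComplex (ModuleCat.{u} A) ℤ}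
    (f : X ⟶ Y) : ChainComplex (ModuleCat.{u} A) ℤ :=
  HomologicalComplex.homotopyCofiber f

section KillHomology

variable {A : Type u} [Ring A]

lemma cyc_lift (K : ChainComplex (ModuleCat.{u} A) ℤ) (q q' : ℤ) (h : q' + 1 = q)
    (x : K.X q) (hx : K.d q q' x = 0) : ∃ c : K.cycles q, K.iCycles q c = x := by
  have hn : (ComplexShape.down ℤ).next q = q' := (ComplexShape.down ℤ).next_eq' h
  refine ⟨K.cyclesMk x q' hn hx, K.i_cyclesMk x q' hn hx⟩

lemma cyc_d (K : ChainComplex (ModuleCat.{u} A) ℤ) (q q' : ℤ) (c : K.cycles q) :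
    K.d q q' (K.iCycles q c) = 0 := by
  have := K.iCycles_d q q'
  exact congr($this c)

lemma cyc_inj (K : ChainComplex (ModuleCat.{u} A) ℤ) (q : ℤ) (c c' : K.cycles q)
    (h : K.iCycles q c = K.iCycles q c') : c = c' :=
  (ModuleCat.mono_iff_injective (K.iCycles q)).1 inferInstance h

lemma hom_surj (K : ChainComplex (ModuleCat.{u} A) ℤ) (q : ℤ) (x : K.homology q) :
    ∃ c, K.homologyπ q c = x :=
  (ModuleCat.epi_iff_surjective (K.homologyπ q)).1 inferInstance x

lemma hom_zero (K : ChainComplex (ModuleCat.{u} A) ℤ) (q'' q : ℤ) (h : q + 1 = q'')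
    (c : K.cycles q) (hc : K.homologyπ q c = 0) :
    ∃ y : K.X q'', K.d q'' q y = K.iCycles q c := by
  have hn : (ComplexShape.down ℤ).prev q = q'' := (ComplexShape.down ℤ).prev_eq' h
  have hex : (ShortComplex.mk (K.toCycles q'' q) (K.homologyπ q)
      (K.toCycles_comp_homologyπ q'' q)).Exact :=
    ShortComplex.exact_of_g_is_cokernel _ (K.homologyIsCokernel q'' q hn)
  obtain ⟨y, hy⟩ := (ShortComplex.moduleCat_exact_iff _).1 hex c hc
  refine ⟨y, ?_⟩
  have := K.toCycles_i q'' q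
  rw [← this, ← hy]
  rfl

lemma hom_bd (K : ChainComplex (ModuleCat.{u} A) ℤ) (q'' q : ℤ)
    (c : K.cycles q) (y : K.X q'') (hy : K.d q'' q y = K.iCycles q c) :
    K.homologyπ q c = 0 := by
  have : c = K.toCycles q'' q y := by
    apply cyc_inj
    rw [← hy]
    have := K.toCycles_i q'' q
    exact congr($this y).symm
  rw [this]
  have := K.toCycles_comp_homologyπ q'' q
  exact congr($this y)

lemma map_π {C D : ChainComplex (ModuleCat.{u} A) ℤ} (j : C ⟶ D) (q : ℤ) (c : C.cycles q) :
    HomologicalComplex.homologyMap j q (C.homologyπ q c)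
      = D.homologyπ q (HomologicalComplex.cyclesMap j q c) := by
  have := HomologicalComplex.homologyπ_naturality j q
  exact congr($this c)

lemma map_i {C D : ChainComplex (ModuleCat.{u} A) ℤ} (j : C ⟶ D) (q : ℤ) (c : C.cycles q) :
    D.iCycles q (HomologicalComplex.cyclesMap j q c) = j.f q (C.iCycles q c) := by
  have := HomologicalComplex.cyclesMap_i j q
  exact congr($this c)

lemma map_d {C D : ChainComplex (ModuleCat.{u} A) ℤ} (j : C ⟶ D) (q q' : ℤ) (c : C.X q) :
    D.d q q' (j.f q c) = j.f q' (C.d q q' c) := by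
  have := j.comm q q'
  exact congr($this c)

lemma homologyMap_inj {C D : ChainComplex (ModuleCat.{u} A) ℤ} (j : C ⟶ D) (q'' q : ℤ)
    (h : q + 1 = q'') (hinj : Function.Injective (j.f q))
    (hsurj : Function.Surjective (j.f q'')) :
    Function.Injective (HomologicalComplex.homologyMap j q) := by
  rw [injective_iff_map_eq_zero]
  intro a ha
  obtain ⟨c, rfl⟩ := hom_surj C q a
  rw [map_π] at ha
  obtain ⟨y, hy⟩ := hom_zero D q'' q h _ ha
  obtain ⟨y', rfl⟩ := hsurj y
  rw [map_i, map_d] at hy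
  exact hom_bd C q'' q c y' (hinj hy)

lemma homologyMap_surj {C D : ChainComplex (ModuleCat.{u} A) ℤ} (j : C ⟶ D) (q q' : ℤ)
    (h : q' + 1 = q) (hinj : Function.Injective (j.f q'))
    (hsurj : Function.Surjective (j.f q)) :
    Function.Surjective (HomologicalComplex.homologyMap j q) := by
  intro a
  obtain ⟨c, rfl⟩ := hom_surj D q a
  obtain ⟨x, hx⟩ := hsurj (D.iCycles q c)
  obtain ⟨c', hc'⟩ := cyc_lift C q q' h x (by
    apply hinj
    rw [← map_d, hx, cyc_d, map_zero])
  refine ⟨C.homologyπ q c', ?_⟩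
  rw [map_π]
  congr 1
  apply cyc_inj
  rw [map_i, hc', hx]

lemma factor_surj {M N Q : Type*} [AddCommGroup M] [AddCommGroup N] [AddCommGroup Q]
    [Module A M] [Module A N] [Module A Q] (p : M →ₗ[A] N) (hp : Function.Surjective p)
    (φ : M →ₗ[A] Q) (h : ∀ x, p x = 0 → φ x = 0) : ∃ ψ : N →ₗ[A] Q, ∀ x, ψ (p x) = φ x := by
  refine ⟨(LinearMap.ker p).liftQ φ (fun x hx => h x hx) ∘ₗ
    (p.quotKerEquivOfSurjective hp).symm.toLinearMap, fun x => ?_⟩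
  have : (p.quotKerEquivOfSurjective hp).symm (p x) = (LinearMap.ker p).mkQ x := by
    rw [LinearEquiv.symm_apply_eq]; rfl
  rw [LinearMap.comp_apply, LinearEquiv.coe_coe, this]
  rfl

lemma attach {C D : ChainComplex (ModuleCat.{u} A) ℤ} (j : C ⟶ D) (n m : ℤ) (hm : n + 1 = m)
    (P : Type u) [AddCommGroup P] [Module A P]
    (hinj : ∀ q, Function.Injective (j.f q))
    (hsurj : ∀ q, q ≠ m → Function.Surjective (j.f q))
    (s : P → D.X m) (π : D.X m →ₗ[A] P)
    (hπj : ∀ x, π (j.f m x) = 0) (hπs : ∀ p, π (s p) = p)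
    (hdec : ∀ x, π x = 0 → ∃ y, j.f m y = x)
    (k : P →ₗ[A] ↥(C.homology n)) (hk : Function.Surjective k)
    (hz : ∀ p, ∃ c : C.cycles n, D.d m n (s p) = j.f n (C.iCycles n c) ∧
      C.homologyπ n c = k p) :
    IsZero (D.homology n) ∧
    (∀ q, q ≠ n → q ≠ m → Nonempty (D.homology q ≅ C.homology q)) ∧
      ∃ (α : ↥(C.homology m) →ₗ[A] ↥(D.homology m))
        (β : ↥(D.homology m) →ₗ[A] ↥(LinearMap.ker k)),
        Function.Injective α ∧ Function.Surjective β ∧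
          LinearMap.range α = LinearMap.ker β := by
  refine ⟨?_, ?_, ?_⟩
  · have hs : ∀ a : D.homology n, a = 0 := by
      intro a
      obtain ⟨a', rfl⟩ := homologyMap_surj j n (n-1) (by ring) (hinj _) (hsurj n (by lia)) a
      obtain ⟨p, rfl⟩ := hk a'
      obtain ⟨c, h1, h2⟩ := hz p
      rw [← h2, map_π]
      exact hom_bd D m n _ (s p) (by rw [map_i, h1])
    have : Subsingleton (D.homology n) := ⟨fun a b => by rw [hs a, hs b]⟩
    exact ModuleCat.isZero_of_subsingleton _
  · intro q hq hqm
    have hb : Function.Bijective (HomologicalComplex.homologyMap j q) :=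
      ⟨homologyMap_inj j (q+1) q rfl (hinj q) (hsurj _ (by lia)),
        homologyMap_surj j q (q-1) (by ring) (hinj _) (hsurj q hqm)⟩
    exact ⟨(LinearEquiv.ofBijective (HomologicalComplex.homologyMap j q).hom hb).symm.toModuleIso⟩
  · have key : ∀ c : D.cycles m, k (π (D.iCycles m c)) = 0 := by
      intro c
      set p := π (D.iCycles m c) with hp
      obtain ⟨y, hy⟩ := hdec (D.iCycles m c - s p) (by rw [map_sub, hπs, hp, sub_self])
      obtain ⟨c', h1, h2⟩ := hz p
      rw [← h2]
      refine hom_bd C m n _ (-y) ?_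
      apply hinj
      rw [← h1, ← map_d, map_neg, hy]
      simp [cyc_d]
    obtain ⟨ψ, hψ⟩ := factor_surj (D.homologyπ m).hom (hom_surj D m)
      ((π ∘ₗ (D.iCycles m).hom).codRestrict (LinearMap.ker k) (fun c => key c)) (by
        intro c hc
        obtain ⟨y, hy⟩ := hom_zero D (m+1) m rfl c hc
        obtain ⟨y', rfl⟩ := hsurj (m+1) (by lia) y
        rw [map_d] at hy
        ext
        change π (D.iCycles m c) = 0
        rw [← hy, hπj])
    have hψ' : ∀ c : D.cycles m, (ψ (D.homologyπ m c)).1 = π (D.iCycles m c) :=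
      fun c => congrArg Subtype.val (hψ c)
    refine ⟨(HomologicalComplex.homologyMap j m).hom, ψ,
      homologyMap_inj j (m+1) m rfl (hinj m) (hsurj _ (by lia)), ?_, ?_⟩
    · rintro ⟨p, hp⟩
      obtain ⟨c, h1, h2⟩ := hz p
      obtain ⟨y, hy⟩ := hom_zero C m n hm c (h2.trans hp)
      obtain ⟨c', hc'⟩ := cyc_lift D m n hm (s p - j.f m y) (by
        rw [map_sub, h1, map_d, hy, sub_self])
      refine ⟨D.homologyπ m c', ?_⟩
      ext
      rw [hψ', hc', map_sub, hπj, hπs, sub_zero]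
    · ext a
      constructor
      · rintro ⟨b, rfl⟩
        obtain ⟨c, rfl⟩ := hom_surj C m b
        rw [LinearMap.mem_ker]
        ext
        change (ψ (HomologicalComplex.homologyMap j m (C.homologyπ m c))).1 = 0
        rw [map_π, hψ', map_i, hπj]
      · intro ha
        obtain ⟨c, rfl⟩ := hom_surj D m a
        have h0 : π (D.iCycles m c) = 0 := by
          rw [← hψ']; exact congrArg Subtype.val ha
        obtain ⟨y, hy⟩ := hdec _ h0
        obtain ⟨c', hc'⟩ := cyc_lift C m n hm y (by
          apply hinj
          rw [← map_d, hy, cyc_d, map_zero])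
        refine ⟨C.homologyπ m c', ?_⟩
        change HomologicalComplex.homologyMap j m (C.homologyπ m c') = _
        rw [map_π]
        congr 1
        apply cyc_inj
        rw [map_i, hc', hy]

open HomologicalComplex in
/-- First projection of the cone. -/
noncomputable def cfst {X Y : ChainComplex (ModuleCat.{u} A) ℤ} (f : X ⟶ Y) (q q' : ℤ)
    (h : q' + 1 = q) : (Cone f).X q ⟶ X.X q' := homotopyCofiber.fstX f q q' h

open HomologicalComplex in
/-- Second projection of the cone. -/
noncomputable def csnd {X Y : ChainComplex (ModuleCat.{u} A) ℤ} (f : X ⟶ Y) (q : ℤ) :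
    (Cone f).X q ⟶ Y.X q := homotopyCofiber.sndX f q

open HomologicalComplex in
/-- First inclusion of the cone. -/
noncomputable def cinl {X Y : ChainComplex (ModuleCat.{u} A) ℤ} (f : X ⟶ Y) (q q' : ℤ)
    (h : q' + 1 = q) : X.X q' ⟶ (Cone f).X q := homotopyCofiber.inlX f q' q h

open HomologicalComplex in
/-- Second inclusion of the cone. -/
noncomputable def cinr {X Y : ChainComplex (ModuleCat.{u} A) ℤ} (f : X ⟶ Y) :
    Y ⟶ Cone f := homotopyCofiber.inr f

variable {X Y : ChainComplex (ModuleCat.{u} A) ℤ} (f : X ⟶ Y) (q q' q'' : ℤ)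
    (h : q' + 1 = q) (h' : q'' + 1 = q')

open HomologicalComplex

lemma cfst_cinl (x : X.X q') : cfst f q q' h (cinl f q q' h x) = x := by
  have := homotopyCofiber.inlX_fstX f q' q h
  exact congr($this x)

lemma csnd_cinl (x : X.X q') : csnd f q (cinl f q q' h x) = 0 := by
  have := homotopyCofiber.inlX_sndX f q' q h
  exact congr($this x)

lemma cfst_cinr (x : Y.X q) : cfst f q q' h ((cinr f).f q x) = 0 := by
  have := homotopyCofiber.inrX_fstX f q q' h
  exact congr($this x)

lemma csnd_cinr (x : Y.X q) : csnd f q ((cinr f).f q x) = x := by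
  have := homotopyCofiber.inrX_sndX f q
  exact congr($this x)

lemma cone_id : homotopyCofiber.fstX f q q' h ≫ homotopyCofiber.inlX f q' q h +
    homotopyCofiber.sndX f q ≫ homotopyCofiber.inrX f q = 𝟙 _ := by
  apply homotopyCofiber.ext_to_X f q q' h
  · rw [Preadditive.add_comp, Category.assoc, Category.assoc]
    erw [homotopyCofiber.inlX_fstX f q' q h, homotopyCofiber.inrX_fstX f q q' h]
    simp
  · rw [Preadditive.add_comp, Category.assoc, Category.assoc]
    erw [homotopyCofiber.inlX_sndX f q' q h, homotopyCofiber.inrX_sndX f q]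
    simp

lemma cone_dec (x : (Cone f).X q) :
    cinl f q q' h (cfst f q q' h x) + (cinr f).f q (csnd f q x) = x := by
  have := cone_id f q q' h
  exact congr($this x)

lemma cone_ext (x y : (Cone f).X q) (h1 : cfst f q q' h x = cfst f q q' h y)
    (h2 : csnd f q x = csnd f q y) : x = y := by
  rw [← cone_dec f q q' h x, ← cone_dec f q q' h y, h1, h2]

lemma cfst_d (x : (Cone f).X q) :
    cfst f q' q'' h' ((Cone f).d q q' x) = - X.d q' q'' (cfst f q q' h x) := by
  have := homotopyCofiber.d_fstX f q q' q'' h h'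
  exact congr($this x)

lemma csnd_d (x : (Cone f).X q) :
    csnd f q' ((Cone f).d q q' x) = f.f q' (cfst f q q' h x) + Y.d q q' (csnd f q x) := by
  have := homotopyCofiber.d_sndX f q q' h
  exact congr($this x)

/-- Chain map from elementwise data. -/
def mkChainMap {C D : ChainComplex (ModuleCat.{u} A) ℤ} (φ : ∀ q, C.X q ⟶ D.X q)
    (hφ : ∀ q q' (_ : q' + 1 = q) (x : C.X q), D.d q q' (φ q x) = φ q' (C.d q q' x)) :
    C ⟶ D where
  f := φ
  comm' i j hij := by
    ext x
    exact hφ i j hij x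

/-- Functoriality of the cone. -/
noncomputable def coneMap {X' Y' : ChainComplex (ModuleCat.{u} A) ℤ} (f' : X' ⟶ Y')
    (a : X ⟶ X') (b : Y ⟶ Y') (hab : a ≫ f' = f ≫ b) : Cone f ⟶ Cone f' :=
  mkChainMap (fun q => cfst f q (q-1) (by ring) ≫ a.f (q-1) ≫ cinl f' q (q-1) (by ring)
      + csnd f q ≫ b.f q ≫ (cinr f').f q) (by
    intro q q' h x
    obtain rfl : q' = q - 1 := by lia
    have hab' : ∀ y, f'.f (q-1) (a.f (q-1) y) = b.f (q-1) (f.f (q-1) y) := fun y => by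
      have := congrArg (fun t => Hom.f t (q-1)) hab
      exact congr($this y)
    change (Cone f').d q (q-1) (cinl f' q (q-1) _ (a.f (q-1) (cfst f q (q-1) _ x)) +
        (cinr f').f q (b.f q (csnd f q x))) =
      cinl f' (q-1) (q-1-1) _ (a.f (q-1-1) (cfst f (q-1) (q-1-1) _ ((Cone f).d q (q-1) x)))
       + (cinr f').f (q-1) (b.f (q-1) (csnd f (q-1) ((Cone f).d q (q-1) x)))
    apply cone_ext f' (q-1) (q-1-1) (by ring)
    · rw [cfst_d f' q (q-1) _ h]
      simp only [map_add, cfst_cinl, cfst_cinr, cfst_d f q (q-1) _ h, map_neg, add_zero,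
        map_d]
    · rw [csnd_d f' q (q-1) h]
      simp only [map_add, csnd_cinl, csnd_cinr, cfst_cinl, cfst_cinr, csnd_d f q (q-1) h,
        add_zero, zero_add, map_d, hab'])

section
variable {X' Y' : ChainComplex (ModuleCat.{u} A) ℤ} (f' : X' ⟶ Y')
    (a : X ⟶ X') (b : Y ⟶ Y') (hab : a ≫ f' = f ≫ b)

lemma coneMap_apply (x : (Cone f).X q) : (coneMap f f' a b hab).f q x =
    cinl f' q q' h (a.f q' (cfst f q q' h x)) + (cinr f').f q (b.f q (csnd f q x)) := by
  obtain rfl : q' = q - 1 := by lia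
  rfl

lemma cfst_coneMap (x : (Cone f).X q) : cfst f' q q' h ((coneMap f f' a b hab).f q x) =
    a.f q' (cfst f q q' h x) := by
  rw [coneMap_apply f q q' h, map_add, cfst_cinl, cfst_cinr, add_zero]

lemma csnd_coneMap (x : (Cone f).X q) : csnd f' q ((coneMap f f' a b hab).f q x) =
    b.f q (csnd f q x) := by
  rw [coneMap_apply f q (q-1) (by ring), map_add, csnd_cinl, csnd_cinr, zero_add]

lemma coneMap_inj (ha : ∀ q, Function.Injective (a.f q)) (hb : ∀ q, Function.Injective (b.f q)) :
    Function.Injective ((coneMap f f' a b hab).f q) := by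
  intro x y hxy
  apply cone_ext f q (q-1) (by ring)
  · apply ha
    rw [← cfst_coneMap f q (q-1) _ f' a b hab, hxy, cfst_coneMap]
  · apply hb
    rw [← csnd_coneMap f q f' a b hab, hxy, csnd_coneMap]

include h in
lemma coneMap_mem (x : (Cone f').X q) (y : X.X q') (hy : a.f q' y = cfst f' q q' h x)
    (z : Y.X q) (hz : b.f q z = csnd f' q x) : ∃ w, (coneMap f f' a b hab).f q w = x := by
  refine ⟨cinl f q q' h y + (cinr f).f q z, ?_⟩
  apply cone_ext f' q q' h
  · rw [cfst_coneMap, map_add, cfst_cinl, cfst_cinr, add_zero, hy]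
  · rw [csnd_coneMap, map_add, csnd_cinl, csnd_cinr, zero_add, hz]

end

lemma cone_id_zero (X : ChainComplex (ModuleCat.{u} A) ℤ) (q : ℤ) (a : (Cone (𝟙 X)).homology q) :
    a = 0 := by
  obtain ⟨c, rfl⟩ := hom_surj _ _ a
  set x := (Cone (𝟙 X)).iCycles q c with hx
  have hd := cyc_d (Cone (𝟙 X)) q (q-1) c
  refine hom_bd _ (q+1) q c (cinl (𝟙 X) (q+1) q rfl (csnd (𝟙 X) q x)) ?_
  apply cone_ext (𝟙 X) q (q-1) (by ring)
  · rw [cfst_d (𝟙 X) (q+1) q (q-1) rfl, cfst_cinl]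
    have h2 := csnd_d (𝟙 X) q (q-1) (by ring) x
    rw [hx, hd, map_zero] at h2
    exact (eq_neg_of_add_eq_zero_left h2.symm).symm
  · rw [csnd_d (𝟙 X) (q+1) q rfl, cfst_cinl, csnd_cinl, map_zero, add_zero]
    rfl

section Construct

variable (m : ℤ) (P : Type u) [AddCommGroup P] [Module A P]

/-- `P` concentrated in degree `m`. -/
noncomputable abbrev TT : ChainComplex (ModuleCat.{u} A) ℤ :=
  (single (ModuleCat.{u} A) (ComplexShape.down ℤ) m).obj (ModuleCat.of A P)

/-- The degree `m` part of `TT`. -/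
noncomputable def eT : (TT (A := A) m P).X m ≅ ModuleCat.of A P :=
  singleObjXSelf (ComplexShape.down ℤ) m _

lemma TT_zero (q : ℤ) (hq : q ≠ m) (x : (TT (A := A) m P).X q) : x = 0 := by
  have : IsZero ((TT (A := A) m P).X q) :=
    isZero_single_obj_X (ComplexShape.down ℤ) m _ q hq
  have := ModuleCat.subsingleton_of_isZero this
  exact Subsingleton.elim _ _

variable {m P}

/-- The attaching map. -/
noncomputable def phi (x : ModuleCat.of A P ⟶ X.X m) (hx : ∀ k, x ≫ X.d m k = 0) :
    TT m P ⟶ X := mkHomFromSingle x (fun k _ => hx k)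

lemma phi_apply (x : ModuleCat.of A P ⟶ X.X m) (hx : ∀ k, x ≫ X.d m k = 0)
    (t : (TT m P).X m) : (phi x hx).f m t = x ((eT m P).hom t) := by
  have := mkHomFromSingle_f x (fun k _ => hx k)
  exact congr($this t)

/-- The nullhomotopy components. -/
noncomputable def eta (y : ModuleCat.of A P ⟶ Y.X (m + 1)) (i j : ℤ) :
    (TT m P).X i ⟶ Y.X j :=
  if hij : i = m ∧ j = m + 1 then
    (singleObjXIsoOfEq (ComplexShape.down ℤ) m (ModuleCat.of A P) i hij.1).hom ≫ (-y) ≫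
      (Y.XIsoOfEq hij.2).inv
  else 0

lemma eta_apply (y : ModuleCat.of A P ⟶ Y.X (m + 1)) (t : (TT m P).X m) :
    eta y m (m + 1) t = - y ((eT m P).hom t) := by
  have : eta y m (m + 1) = (eT m P).hom ≫ (-y) := by
    simp [eta, eT]
    rfl
  rw [this]
  rfl

/-- The extension of `f`. -/
noncomputable def gg (x : ModuleCat.of A P ⟶ X.X m) (hx : ∀ k, x ≫ X.d m k = 0)
    (y : ModuleCat.of A P ⟶ Y.X (m + 1)) (hy : x ≫ f.f m + y ≫ Y.d (m + 1) m = 0) :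
    Cone (phi x hx) ⟶ Y :=
  mkChainMap (fun q => cfst (phi x hx) q (q-1) (by ring) ≫ eta y (q-1) q +
    csnd (phi x hx) q ≫ f.f q) (by
    intro q q' h c
    obtain rfl : q' = q - 1 := by lia
    change Y.d q (q-1) (eta y (q-1) q (cfst (phi x hx) q (q-1) _ c) +
        f.f q (csnd (phi x hx) q c)) =
      eta y (q-1-1) (q-1) (cfst (phi x hx) (q-1) (q-1-1) _ ((Cone (phi x hx)).d q (q-1) c)) +
        f.f (q-1) (csnd (phi x hx) (q-1) ((Cone (phi x hx)).d q (q-1) c))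
    have h0 : cfst (phi x hx) (q-1) (q-1-1) (by ring) ((Cone (phi x hx)).d q (q-1) c) = 0 := by
      rw [cfst_d (phi x hx) q (q-1) _ h]
      simp
    rw [h0, map_zero, zero_add, csnd_d (phi x hx) q (q-1) h, map_add, map_add, map_d]
    congr 1
    generalize cfst (phi x hx) q (q-1) h c = t
    by_cases hq : q - 1 = m
    · obtain rfl : q = m + 1 := by lia
      revert t
      generalize hr : m + 1 - 1 = r
      obtain rfl : r = m := by lia
      intro t
      rw [eta_apply, phi_apply, map_neg, neg_eq_iff_add_eq_zero, add_comm]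
      exact congr($hy _)
    · rw [TT_zero m P _ hq t, map_zero, map_zero, map_zero, map_zero])

variable (x : ModuleCat.of A P ⟶ X.X m) (hx : ∀ k, x ≫ X.d m k = 0)
    (y : ModuleCat.of A P ⟶ Y.X (m + 1)) (hy : x ≫ f.f m + y ≫ Y.d (m + 1) m = 0)

lemma gg_apply (c : (Cone (phi x hx)).X (m+1)) : (gg f x hx y hy).f (m+1) c =
    - y ((eT m P).hom (cfst (phi x hx) (m+1) m rfl c)) + f.f (m+1) (csnd (phi x hx) (m+1) c) := by
  have : ∀ r (h : r + 1 = m + 1), eta y r (m+1) (cfst (phi x hx) (m+1) r h c) =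
      - y ((eT m P).hom (cfst (phi x hx) (m+1) m rfl c)) := by
    intro r h
    obtain rfl : r = m := by lia
    rw [eta_apply]
  change eta y (m+1-1) (m+1) (cfst (phi x hx) (m+1) (m+1-1) _ c) + _ = _
  rw [this]
  rfl

lemma i_gg : cinr (phi x hx) ≫ gg f x hx y hy = f := by
  ext q t
  change eta y (q-1) q (cfst (phi x hx) q (q-1) _ ((cinr (phi x hx)).f q t)) +
    f.f q (csnd (phi x hx) q ((cinr (phi x hx)).f q t)) = _
  rw [cfst_cinr, csnd_cinr, map_zero, zero_add]

lemma i_inj (q : ℤ) : Function.Injective ((cinr (phi x hx)).f q) := by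
  intro a b hab
  rw [← csnd_cinr (phi x hx) q a, hab, csnd_cinr]

lemma i_surj (q : ℤ) (hq : q ≠ m + 1) : Function.Surjective ((cinr (phi x hx)).f q) := by
  intro a
  refine ⟨csnd _ q a, ?_⟩
  have h := cone_dec (phi x hx) q (q-1) (by ring) a
  rwa [TT_zero m P _ (by lia) (cfst (phi x hx) q (q-1) _ a), map_zero, zero_add] at h

lemma attach_g (k : P →ₗ[A] ↥((Cone f).homology (m + 1))) (hk : Function.Surjective k)
    (hxy : ∀ p, ∃ c : (Cone f).cycles (m + 1), (Cone f).homologyπ (m+1) c = k p ∧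
      x p = cfst f (m+1) m rfl ((Cone f).iCycles (m+1) c) ∧
      y p = csnd f (m+1) ((Cone f).iCycles (m+1) c)) :
    IsZero ((Cone (gg f x hx y hy)).homology (m+1)) ∧
      (∀ q : ℤ, q ≠ m + 1 → q ≠ m + 1 + 1 →
        Nonempty ((Cone (gg f x hx y hy)).homology q ≅ (Cone f).homology q)) ∧
      ∃ (α : ↥((Cone f).homology (m + 1 + 1)) →ₗ[A] ↥((Cone (gg f x hx y hy)).homology (m+1+1)))
        (β : ↥((Cone (gg f x hx y hy)).homology (m+1+1)) →ₗ[A] ↥(LinearMap.ker k)),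
        Function.Injective α ∧ Function.Surjective β ∧
          LinearMap.range α = LinearMap.ker β := by
  set g := gg f x hx y hy with hg
  have hab : cinr (phi x hx) ≫ g = f ≫ 𝟙 Y := by rw [hg, i_gg, Category.comp_id]
  refine attach (coneMap f g (cinr (phi x hx)) (𝟙 Y) hab) (m+1) (m+1+1) rfl P ?_ ?_
    (fun p => cinl g (m+1+1) (m+1) rfl (cinl (phi x hx) (m+1) m rfl ((eT m P).inv (-p))))
    (-((cfst g (m+1+1) (m+1) rfl) ≫ cfst (phi x hx) (m+1) m rfl ≫ (eT m P).hom).hom)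
    ?_ ?_ ?_ k hk ?_
  · intro q
    exact coneMap_inj _ _ _ _ _ _ (i_inj x hx) (fun q => Function.injective_id)
  · intro q hq c
    obtain ⟨t, ht⟩ := i_surj x hx (q-1) (by lia) (cfst g q (q-1) (by ring) c)
    exact coneMap_mem f q (q-1) (by ring) g _ _ hab c t ht (csnd g q c) rfl
  · intro c
    change -(eT m P).hom (cfst (phi x hx) (m+1) m rfl (cfst g (m+1+1) (m+1) rfl _)) = 0
    rw [cfst_coneMap, cfst_cinr, map_zero, neg_zero]
  · intro p
    change -(eT m P).hom (cfst (phi x hx) (m+1) m rfl (cfst g (m+1+1) (m+1) rfl _)) = p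
    rw [cfst_cinl, cfst_cinl]
    have : (eT (A := A) m P).hom ((eT m P).inv (-p)) = -p := by
      have := (eT (A := A) m P).inv_hom_id
      exact congr($this (-p))
    rw [this, neg_neg]
  · intro c hc
    change -(eT m P).hom (cfst (phi x hx) (m+1) m rfl (cfst g (m+1+1) (m+1) rfl c)) = 0 at hc
    have h0 : cfst (phi x hx) (m+1) m rfl (cfst g (m+1+1) (m+1) rfl c) = 0 := by
      have h1 := (eT (A := A) m P).hom_inv_id
      have h2 := congr($h1 (cfst (phi x hx) (m+1) m rfl (cfst g (m+1+1) (m+1) rfl c)))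
      change (eT m P).inv ((eT m P).hom _) = _ at h2
      rw [neg_eq_zero.1 hc, map_zero] at h2
      exact h2.symm
    have h3 := cone_dec (phi x hx) (m+1) m rfl (cfst g (m+1+1) (m+1) rfl c)
    rw [h0, map_zero, zero_add] at h3
    exact coneMap_mem f (m+1+1) (m+1) rfl g _ _ hab c _ h3 (csnd g _ c) rfl
  · intro p
    obtain ⟨c, h1, h2, h3⟩ := hxy p
    refine ⟨c, ?_, h1⟩
    have h4 : (eT (A := A) m P).hom ((eT m P).inv (-p)) = -p := by
      have := (eT (A := A) m P).inv_hom_id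
      exact congr($this (-p))
    apply cone_ext g (m+1) m rfl
    · rw [cfst_d g (m+1+1) (m+1) m rfl, cfst_cinl, cfst_coneMap]
      apply cone_ext (phi x hx) m (m-1) (by ring)
      · rw [map_neg, cfst_d (phi x hx) (m+1) m (m-1) rfl, cfst_cinr]
        simp
      · rw [map_neg, csnd_d (phi x hx) (m+1) m rfl, csnd_cinr, cfst_cinl, csnd_cinl, map_zero,
          add_zero, phi_apply, h4, ← h2]
        erw [map_neg, neg_neg]
    · rw [csnd_d g (m+1+1) (m+1) rfl, csnd_coneMap, cfst_cinl, csnd_cinl, map_zero, add_zero, ← h3,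
        hg, gg_apply, cfst_cinl, csnd_cinl, h4, map_zero, add_zero]
      erw [map_neg, neg_neg]
      rfl

lemma attach_i :
    (∀ q : ℤ, q ≠ m + 1 → IsZero ((Cone (cinr (phi x hx))).homology q)) ∧
      Nonempty ((Cone (cinr (phi x hx))).homology (m+1) ≅ ModuleCat.of A P) := by
  set i := cinr (phi x hx) with hi
  have hab : 𝟙 X ≫ i = 𝟙 X ≫ i := rfl
  have hC : ∀ q, IsZero ((Cone (𝟙 X)).homology q) := fun q => by
    have : Subsingleton ((Cone (𝟙 X)).homology q) :=
      ⟨fun a b => by rw [cone_id_zero X q a, cone_id_zero X q b]⟩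
    exact ModuleCat.isZero_of_subsingleton _
  have h4 : ∀ p, (eT (A := A) m P).hom ((eT m P).inv p) = p := fun p => by
    have := (eT (A := A) m P).inv_hom_id
    exact congr($this p)
  refine (fun H => ?_) (attach (coneMap (𝟙 X) i (𝟙 X) i hab) m (m+1) rfl P ?_ ?_
    (fun p => (cinr i).f (m+1) (cinl (phi x hx) (m+1) m rfl ((eT m P).inv p)))
    ((csnd i (m+1)) ≫ cfst (phi x hx) (m+1) m rfl ≫ (eT m P).hom).hom
    ?_ ?_ ?_ 0 (fun a => ⟨0, by rw [map_zero, cone_id_zero X m a]⟩) ?_)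
  · obtain ⟨H1, H2, α, β, H3, H4, H5⟩ := H
    refine ⟨fun q hq => ?_, ?_⟩
    · by_cases hqm : q = m
      · exact hqm ▸ H1
      · obtain ⟨e⟩ := H2 q hqm hq
        exact (hC q).of_iso e
    · have hb : Function.Bijective β := by
        refine ⟨?_, H4⟩
        rw [← LinearMap.ker_eq_bot, ← H5, LinearMap.range_eq_bot]
        ext a
        rw [cone_id_zero X _ a, map_zero, map_zero]
      exact ⟨((LinearEquiv.ofBijective β hb).trans
        ((LinearEquiv.ofEq _ _ LinearMap.ker_zero).trans Submodule.topEquiv)).toModuleIso⟩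
  · intro q
    exact coneMap_inj _ _ _ _ _ _ (fun q => Function.injective_id) (i_inj x hx)
  · intro q hq c
    obtain ⟨t, ht⟩ := i_surj x hx q hq (csnd i q c)
    exact coneMap_mem (𝟙 X) q (q-1) (by ring) i _ _ hab c (cfst i q (q-1) (by ring) c) rfl t ht
  · intro c
    change (eT m P).hom (cfst (phi x hx) (m+1) m rfl (csnd i (m+1) _)) = 0
    rw [csnd_coneMap, hi, cfst_cinr, map_zero]
  · intro p
    change (eT m P).hom (cfst (phi x hx) (m+1) m rfl (csnd i (m+1) _)) = p
    rw [csnd_cinr, cfst_cinl, h4]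
  · intro c hc
    change (eT m P).hom (cfst (phi x hx) (m+1) m rfl (csnd i (m+1) c)) = 0 at hc
    have h0 : cfst (phi x hx) (m+1) m rfl (csnd i (m+1) c) = 0 := by
      have h1 := (eT (A := A) m P).hom_inv_id
      have h2 := congr($h1 (cfst (phi x hx) (m+1) m rfl (csnd i (m+1) c)))
      change (eT m P).inv ((eT m P).hom _) = _ at h2
      rw [hc, map_zero] at h2
      exact h2.symm
    have h3 := cone_dec (phi x hx) (m+1) m rfl (csnd i (m+1) c)
    rw [h0, map_zero, zero_add] at h3
    exact coneMap_mem (𝟙 X) (m+1) m rfl i _ _ hab c (cfst i (m+1) m rfl c) rfl _ h3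
  · intro p
    have hxp : X.d m (m-1) (x p) = 0 := by
      have := hx (m-1)
      exact congr($this p)
    obtain ⟨c, hc⟩ := cyc_lift (Cone (𝟙 X)) m (m-1) (by ring) ((cinr (𝟙 X)).f m (x p)) (by
      rw [map_d, hxp, map_zero])
    refine ⟨c, ?_, cone_id_zero X m _⟩
    rw [hc, map_d]
    apply cone_ext i m (m-1) (by ring)
    · rw [cfst_coneMap, cfst_cinr, cfst_cinr, map_zero]
    · rw [csnd_coneMap, csnd_cinr, csnd_cinr]
      apply cone_ext (phi x hx) m (m-1) (by ring)
      · rw [cfst_d (phi x hx) (m+1) m (m-1) rfl, hi, cfst_cinr]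
        simp
      · rw [csnd_d (phi x hx) (m+1) m rfl, hi, csnd_cinr, cfst_cinl, csnd_cinl, map_zero,
          add_zero, phi_apply, h4]

end Construct


lemma kill_aux (X Y : ChainComplex (ModuleCat.{u} A) ℤ)
    (hX : ∀ q : ℤ, q < 0 → IsZero (X.X q))
    (f : X ⟶ Y)
    (P : Type u) [AddCommGroup P] [Module A P] [Module.Projective A P]
    (m : ℤ) (hm : 0 ≤ m + 1)
    (k : P →ₗ[A] ↥((Cone f).homology (m + 1)))
    (hk : Function.Surjective k) :
    ∃ (X' : ChainComplex (ModuleCat.{u} A) ℤ) (i : X ⟶ X') (g : X' ⟶ Y),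
      (∀ q : ℤ, q < 0 → IsZero (X'.X q)) ∧
      (∀ q : ℤ, q ≠ m + 1 → ∃ e : X'.X q ≅ X.X q, i.f q ≫ e.hom = 𝟙 (X.X q)) ∧
      (∃ e : X'.X (m + 1) ≅ (X.X (m + 1)) ⊞ (ModuleCat.of A P),
        i.f (m + 1) ≫ e.hom = biprod.inl) ∧
      i ≫ g = f ∧
      (∀ q : ℤ, q ≠ m + 1 → IsZero ((Cone i).homology q)) ∧
      Nonempty ((Cone i).homology (m + 1) ≅ ModuleCat.of A P) ∧
      IsZero ((Cone g).homology (m + 1)) ∧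
      (∀ q : ℤ, q ≠ m + 1 → q ≠ m + 1 + 1 →
        Nonempty ((Cone g).homology q ≅ (Cone f).homology q)) ∧
      ∃ (α : ↥((Cone f).homology (m + 1 + 1)) →ₗ[A] ↥((Cone g).homology (m + 1 + 1)))
        (β : ↥((Cone g).homology (m + 1 + 1)) →ₗ[A] ↥(LinearMap.ker k)),
        Function.Injective α ∧ Function.Surjective β ∧
          LinearMap.range α = LinearMap.ker β := by
  obtain ⟨z, hz⟩ := Module.projective_lifting_property ((Cone f).homologyπ (m+1)).hom k
    (hom_surj (Cone f) (m+1))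
  set w : ModuleCat.of A P ⟶ (Cone f).X (m+1) := ModuleCat.ofHom z ≫ (Cone f).iCycles (m+1) with hw
  set x : ModuleCat.of A P ⟶ X.X m := w ≫ cfst f (m+1) m rfl with hxdef
  set y : ModuleCat.of A P ⟶ Y.X (m+1) := w ≫ csnd f (m+1) with hydef
  have hwd : ∀ p : P, (Cone f).d (m+1) m (w p) = 0 := fun p => cyc_d (Cone f) (m+1) m (z p)
  have hx : ∀ k, x ≫ X.d m k = 0 := by
    intro k
    by_cases hkm : k + 1 = m
    · ext p
      have h1 := cfst_d f (m+1) m k rfl hkm (w p)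
      rw [hwd, map_zero] at h1
      exact neg_eq_zero.1 h1.symm
    · rw [X.shape _ _ hkm, comp_zero]
  have hy : x ≫ f.f m + y ≫ Y.d (m + 1) m = 0 := by
    ext p
    have h1 := csnd_d f (m+1) m rfl (w p)
    rw [hwd, map_zero] at h1
    exact h1.symm
  have Hi := attach_i x hx
  have Hg := attach_g f x hx y hy k hk (fun p => ⟨z p, congr($hz p), rfl, rfl⟩)
  refine ⟨Cone (phi x hx), cinr (phi x hx), gg f x hx y hy, ?_, ?_, ?_, i_gg f x hx y hy,
    Hi.1, Hi.2, Hg⟩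
  · intro q hq
    have := ModuleCat.subsingleton_of_isZero (hX q hq)
    have : Subsingleton ((Cone (phi x hx)).X q) :=
      (i_surj x hx q (by lia)).subsingleton
    exact ModuleCat.isZero_of_subsingleton _
  · intro q hq
    let e := (LinearEquiv.ofBijective ((cinr (phi x hx)).f q).hom
      ⟨i_inj x hx q, i_surj x hx q hq⟩).toModuleIso
    exact ⟨e.symm, e.hom_inv_id⟩
  · refine ⟨⟨biprod.lift (csnd (phi x hx) (m+1)) (cfst (phi x hx) (m+1) m rfl ≫ (eT m P).hom),
      biprod.desc ((cinr (phi x hx)).f (m+1)) ((eT m P).inv ≫ cinl (phi x hx) (m+1) m rfl),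
      ?_, ?_⟩, ?_⟩
    · rw [biprod.lift_desc]
      simp only [Category.assoc, Iso.hom_inv_id_assoc]
      exact (add_comm _ _).trans (cone_id (phi x hx) (m+1) m rfl)
    · have h1 : (cinr (phi x hx)).f (m+1) ≫ csnd (phi x hx) (m+1) = 𝟙 _ := by
        ext t; exact csnd_cinr _ _ t
      have h2 : (cinr (phi x hx)).f (m+1) ≫ cfst (phi x hx) (m+1) m rfl = 0 := by
        ext t; exact cfst_cinr _ _ _ _ t
      have h3 : cinl (phi x hx) (m+1) m rfl ≫ csnd (phi x hx) (m+1) = 0 := by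
        ext t; exact csnd_cinl _ _ _ _ t
      have h4 : cinl (phi x hx) (m+1) m rfl ≫ cfst (phi x hx) (m+1) m rfl = 𝟙 _ := by
        ext t; exact cfst_cinl _ _ _ _ t
      apply biprod.hom_ext' <;> apply biprod.hom_ext
      · simp [h1]
      · simp [reassoc_of% h2]
      · simp [h3]
      · simp [reassoc_of% h4]
    · have h1 : (cinr (phi x hx)).f (m+1) ≫ csnd (phi x hx) (m+1) = 𝟙 _ := by
        ext t; exact csnd_cinr _ _ t
      have h2 : (cinr (phi x hx)).f (m+1) ≫ cfst (phi x hx) (m+1) m rfl = 0 := by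
        ext t; exact cfst_cinr _ _ _ _ t
      apply biprod.hom_ext
      · simp [h1]
      · simp [reassoc_of% h2]

end KillHomology

/-- Killing a relative homology class.  Given `f : X ⟶ Y`, a projective
module `P` and a surjection `k : P ↠ H_n(cone f)`, one can attach `P` to `X` in degree `n`,
obtaining a factorization `X ⟶ X′ ⟶ Y` with `X′_q = X_q` for `q ≠ n`, `X′_n = X_n ⊕ P`,
`H_*(cone i)` equal to `P` concentrated in degree `n`, `H_n(cone g) = 0`,
`H_q(cone g) ≅ H_q(cone f)` for `q ∉ {n, n+1}`, and a short exact sequence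
`0 → H_{n+1}(cone f) → H_{n+1}(cone g) → ker k → 0`. -/
theorem stmt8 {A : Type u} [Ring A]
    (X Y : ChainComplex (ModuleCat.{u} A) ℤ)
    (hX : ∀ q : ℤ, q < 0 → IsZero (X.X q)) (hY : ∀ q : ℤ, q < 0 → IsZero (Y.X q))
    (f : X ⟶ Y)
    (P : Type u) [AddCommGroup P] [Module A P] [Module.Projective A P]
    (n : ℕ)
    (k : P →ₗ[A] ↥((Cone f).homology (n : ℤ)))
    (hk : Function.Surjective k) :
    ∃ (X' : ChainComplex (ModuleCat.{u} A) ℤ) (i : X ⟶ X') (g : X' ⟶ Y),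
      (∀ q : ℤ, q < 0 → IsZero (X'.X q)) ∧
      (∀ q : ℤ, q ≠ (n : ℤ) → ∃ e : X'.X q ≅ X.X q, i.f q ≫ e.hom = 𝟙 (X.X q)) ∧
      (∃ e : X'.X (n : ℤ) ≅ (X.X (n : ℤ)) ⊞ (ModuleCat.of A P),
        i.f (n : ℤ) ≫ e.hom = biprod.inl) ∧
      i ≫ g = f ∧
      (∀ q : ℤ, q ≠ (n : ℤ) → IsZero ((Cone i).homology q)) ∧
      Nonempty ((Cone i).homology (n : ℤ) ≅ ModuleCat.of A P) ∧
      IsZero ((Cone g).homology (n : ℤ)) ∧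
      (∀ q : ℤ, q ≠ (n : ℤ) → q ≠ (n : ℤ) + 1 →
        Nonempty ((Cone g).homology q ≅ (Cone f).homology q)) ∧
      ∃ (α : ↥((Cone f).homology ((n : ℤ) + 1)) →ₗ[A] ↥((Cone g).homology ((n : ℤ) + 1)))
        (β : ↥((Cone g).homology ((n : ℤ) + 1)) →ₗ[A] ↥(LinearMap.ker k)),
        Function.Injective α ∧ Function.Surjective β ∧
          LinearMap.range α = LinearMap.ker β := by
  obtain ⟨m, hm⟩ : ∃ m : ℤ, m + 1 = (n : ℤ) := ⟨n - 1, by ring⟩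
  have hn : 0 ≤ (n : ℤ) := Int.natCast_nonneg n
  generalize (n : ℤ) = N at *
  subst hm
  exact kill_aux X Y hX f P m hn k hk
end

section
/- Let A be a ring, f : X → Y a map of nonnegatively graded chain complexes of A-modules, and P an A-module admitting a length-one projective resolution, i.e. a short exact sequence 0 → P₁ → P₀ → P → 0 with P₀ and P₁ projective A-modules. Let n be a natural number and k : P → H_n(cone f) a surjective A-linear map. Then there exist a nonnegatively graded chain complex X′ with X′_q = X_q for q ∉ {n, n+1}, X′_n = X_n ⊕ P₀ and X′_{n+1} = X_{n+1} ⊕ P₁, a chain map i : X → X′ which in each degree is the canonical inclusion, and a chain map g : X′ → Y with g ∘ i = f, such that: (1) H_q(cone i) = 0 for q ≠ n and H_n(cone i) ≅ P; (2) H_n(cone g) = 0; (3) H_q(cone g) ≅ H_q(cone f) for all q ∉ {n, n+1}; and (4) there is a short exact sequence 0 → H_{n+1}(cone f) → H_{n+1}(cone g) → ker k → 0. -/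
open CategoryTheory Limits

universe u

open HomologicalComplex

section helpers

variable {A : Type u} [Ring A]

/-- The shift of a chain complex, with a sign on the differential. -/
noncomputable def shC (K : ChainComplex (ModuleCat.{u} A) ℤ) : ChainComplex (ModuleCat.{u} A) ℤ where
  X q := K.X (q - 1)
  d i j := - K.d (i - 1) (j - 1)
  shape i j h := by
    rw [K.shape, neg_zero]
    intro h'
    apply h
    simp only [ComplexShape.down_Rel] at h' ⊢
    omega
  d_comp_d' i j k _ _ := by simp

theorem relSub (q : ℤ) : (ComplexShape.down ℤ).Rel q (q - 1) := by simp
theorem relAdd (q : ℤ) : (ComplexShape.down ℤ).Rel (q + 1) q := by simp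

/-- The projection from the cone to the shift. -/
noncomputable def fstC {F G : ChainComplex (ModuleCat.{u} A) ℤ} (φ : F ⟶ G) :
    homotopyCofiber φ ⟶ shC F where
  f q := homotopyCofiber.fstX φ q (q - 1) (relSub q)
  comm' i j h := by
    obtain rfl : j = i - 1 := by simp at h; omega
    change _ ≫ (- F.d (i-1) (i-1-1)) = homotopyCofiber.d φ _ _ ≫ _
    rw [homotopyCofiber.d_fstX φ _ _ _ (relSub _) (relSub _)]
    simp

/-- Functoriality of the shift. -/
noncomputable def shM {F G : ChainComplex (ModuleCat.{u} A) ℤ} (φ : F ⟶ G) :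
    shC F ⟶ shC G where
  f q := φ.f (q - 1)
  comm' i j h := by
    change _ ≫ (- G.d (i-1) (j-1)) = (- F.d (i-1) (j-1)) ≫ _
    simp

/-- Minus the identity as an isomorphism. -/
noncomputable def negIso (M : ModuleCat.{u} A) : M ≅ M where
  hom := - 𝟙 M
  inv := - 𝟙 M

/-- Homology of the shift. -/
noncomputable def shHomologyIso (K : ChainComplex (ModuleCat.{u} A) ℤ) (i : ℤ) :
    (shC K).homology i ≅ K.homology (i - 1) :=
  ((shC K).homologyIsoSc' (i + 1) i (i - 1) (by simp) (by simp)) ≪≫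
  ShortComplex.homologyMapIso (ShortComplex.isoMk
    (S₁ := (shC K).sc' (i + 1) i (i - 1)) (S₂ := K.sc' (i + 1 - 1) (i - 1) (i - 1 - 1))
    (Iso.refl (K.X (i + 1 - 1)))
    (negIso (K.X (i - 1)))
    (Iso.refl (K.X (i - 1 - 1)))
    (by
      change 𝟙 _ ≫ K.d (i + 1 - 1) (i - 1) = (- K.d (i + 1 - 1) (i - 1)) ≫ (- 𝟙 (K.X (i - 1)))
      simp)
    (by
      change (- 𝟙 (K.X (i - 1))) ≫ K.d (i - 1) (i - 1 - 1) = (- K.d (i - 1) (i - 1 - 1)) ≫ 𝟙 _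
      simp)) ≪≫
  (K.homologyIsoSc' (i + 1 - 1) (i - 1) (i - 1 - 1) (by simp) (by simp)).symm

theorem augIso (T : ChainComplex (ModuleCat.{u} A) ℤ) (i j : ℤ) (hij : (ComplexShape.down ℤ).Rel i j)
    {P P₀ P₁ : ModuleCat.{u} A} (a : P₁ ⟶ P₀) (p : P₀ ⟶ P) [Epi p] (w : a ≫ p = 0)
    (ex : (ShortComplex.mk a p w).Exact)
    (x₃ : P₀ ≅ T.X i) (x₄ : P₁ ≅ T.X (i + 1)) (hd : T.d i j = 0)
    (hx : x₄.hom ≫ T.d (i + 1) i = a ≫ x₃.hom) :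
    ∃ e : P ≅ T.homology i,
      p ≫ e.hom = T.liftCycles x₃.hom j ((ComplexShape.down ℤ).next_eq' hij) (by simp [hd]) ≫
        T.homologyπ i := by
  let c := T.liftCycles x₃.hom j ((ComplexShape.down ℤ).next_eq' hij) (by simp [hd])
  have hc : c ≫ T.iCycles i = x₃.hom := by simp [c]
  have : IsIso (T.iCycles i) := T.isIso_iCycles i j ((ComplexShape.down ℤ).next_eq' hij) hd
  have : IsIso c := by
    have : IsIso (c ≫ T.iCycles i) := by rw [hc]; infer_instance
    exact IsIso.of_isIso_comp_right c (T.iCycles i)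
  have h4 : x₄.hom ≫ T.toCycles (i + 1) i = a ≫ c := by
    rw [← cancel_mono (T.iCycles i)]
    simp [hc, hx]
  let h1 := ex.gIsCokernel
  let h2 := T.homologyIsCokernel (i + 1) i ((ComplexShape.down ℤ).prev_eq' (relAdd i))
  have hz : a ≫ c ≫ T.homologyπ i = 0 := by
    rw [← Category.assoc, ← h4]; simp
  obtain ⟨u, hu⟩ := CokernelCofork.IsColimit.desc' h1 (c ≫ T.homologyπ i) hz
  obtain ⟨v, hv⟩ := CokernelCofork.IsColimit.desc' h2 (inv c ≫ p) (by
    rw [← cancel_epi x₄.hom, ← Category.assoc, h4]; simp [w])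
  change p ≫ u = _ at hu
  change T.homologyπ i ≫ v = _ at hv
  refine ⟨⟨u, v, ?_, ?_⟩, hu⟩
  · rw [← cancel_epi p, ← Category.assoc, hu]; simp [hv]
  · rw [← cancel_epi (T.homologyπ i), ← Category.assoc, hv]; simp [hu]

variable {W X Y : ChainComplex (ModuleCat.{u} A) ℤ} (ψ : W ⟶ X) (f : X ⟶ Y)
  (h : Homotopy (ψ ≫ f) 0)

open homotopyCofiber in
/-- The inclusion of the cone of `f` in the cone of the extension. -/
noncomputable def jC : homotopyCofiber f ⟶ homotopyCofiber (desc ψ f h) where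
  f q := fstX f q (q - 1) (relSub q) ≫ inrX ψ (q - 1) ≫ inlX (desc ψ f h) (q - 1) q (relSub q) +
    sndX f q ≫ inrX (desc ψ f h) q
  comm' i j hij := by
    obtain rfl : j = i - 1 := by simp at hij; omega
    change _ ≫ homotopyCofiber.d _ _ _ = homotopyCofiber.d _ _ _ ≫ _
    apply ext_from_X f (i - 1) i (relSub i)
    · simp [inlX_d_assoc f i (i-1) (i-1-1) (relSub _) (relSub _), inlX_d (desc ψ f h) i (i-1) (i-1-1) (relSub _) (relSub _)]
    · simp

open homotopyCofiber in
theorem jC_fst : jC ψ f h ≫ fstC (desc ψ f h) ≫ shM (fstC ψ) = 0 := by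
  ext q : 1
  change (fstX f q (q - 1) (relSub q) ≫ inrX ψ (q - 1) ≫ inlX (desc ψ f h) (q - 1) q (relSub q) +
    sndX f q ≫ inrX (desc ψ f h) q) ≫ fstX (desc ψ f h) q (q - 1) (relSub q) ≫
      fstX ψ (q - 1) (q - 1 - 1) (relSub _) = 0
  simp

/-- The short complex of cones. -/
noncomputable def coneSC : ShortComplex (ChainComplex (ModuleCat.{u} A) ℤ) :=
  ShortComplex.mk (jC ψ f h) (fstC (homotopyCofiber.desc ψ f h) ≫ shM (fstC ψ)) (jC_fst ψ f h)

open homotopyCofiber in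
theorem coneSC_shortExact : (coneSC ψ f h).ShortExact := by
  apply HomologicalComplex.shortExact_of_degreewise_shortExact
  intro q
  let r : homotopyCofiber.X (desc ψ f h) q ⟶ homotopyCofiber.X f q :=
    fstX (desc ψ f h) q (q - 1) (relSub q) ≫ sndX ψ (q - 1) ≫ inlX f (q - 1) q (relSub q) +
      sndX (desc ψ f h) q ≫ inrX f q
  let s : W.X (q - 1 - 1) ⟶ homotopyCofiber.X (desc ψ f h) q :=
    inlX ψ (q - 1 - 1) (q - 1) (relSub _) ≫ inlX (desc ψ f h) (q - 1) q (relSub q)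
  refine ShortComplex.Splitting.shortExact ⟨r, s, ?_, ?_, ?_⟩
  · change (fstX f q (q - 1) (relSub q) ≫ inrX ψ (q - 1) ≫
      inlX (desc ψ f h) (q - 1) q (relSub q) + sndX f q ≫ inrX (desc ψ f h) q) ≫ r = 𝟙 _
    apply ext_from_X f (q - 1) q (relSub q)
    · simp [r]
    · simp [r]
  · change s ≫ fstX (desc ψ f h) q (q - 1) (relSub q) ≫
      fstX ψ (q - 1) (q - 1 - 1) (relSub _) = 𝟙 _
    simp [s]
  · change r ≫ (fstX f q (q - 1) (relSub q) ≫ inrX ψ (q - 1) ≫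
      inlX (desc ψ f h) (q - 1) q (relSub q) + sndX f q ≫ inrX (desc ψ f h) q) +
      (fstX (desc ψ f h) q (q - 1) (relSub q) ≫
      fstX ψ (q - 1) (q - 1 - 1) (relSub _)) ≫ s = 𝟙 _
    apply ext_from_X (desc ψ f h) (q - 1) q (relSub q)
    · apply ext_from_X ψ (q - 1 - 1) (q - 1) (relSub _)
      · simp [r, s]
      · simp [r, s]
    · simp [r, s]

open homotopyCofiber in
/-- The projection of the cone of `inr` to the shift. -/
noncomputable def rC : homotopyCofiber (inr ψ) ⟶ shC W where
  f q := sndX (inr ψ) q ≫ fstX ψ q (q - 1) (relSub q)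
  comm' i j hij := by
    obtain rfl : j = i - 1 := by simp at hij; omega
    change (sndX (inr ψ) i ≫ fstX ψ i (i - 1) (relSub i)) ≫ (- W.d (i - 1) (i - 1 - 1)) =
      homotopyCofiber.d (inr ψ) i (i - 1) ≫ sndX (inr ψ) (i - 1) ≫
        fstX ψ (i - 1) (i - 1 - 1) (relSub _)
    apply ext_from_X (inr ψ) (i - 1) i (relSub i)
    · simp [d_sndX_assoc _ _ _ (relSub i)]
    · simp [d_fstX _ _ _ _ (relSub i) (relSub _)]

open homotopyCofiber in
/-- The section of `rC`. -/
noncomputable def sC : shC W ⟶ homotopyCofiber (inr ψ) where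
  f q := inlX ψ (q - 1) q (relSub q) ≫ inrX (inr ψ) q - ψ.f (q - 1) ≫ inlX (inr ψ) (q - 1) q (relSub q)
  comm' i j hij := by
    obtain rfl : j = i - 1 := by simp at hij; omega
    change _ ≫ homotopyCofiber.d _ _ _ = (- W.d _ _) ≫ _
    simp [inlX_d_assoc ψ i (i-1) (i-1-1) (relSub _) (relSub _),
      inlX_d (inr ψ) i (i-1) (i-1-1) (relSub _) (relSub _)]

open homotopyCofiber in
theorem sC_rC : sC ψ ≫ rC ψ = 𝟙 _ := by
  ext q : 1
  change (inlX ψ (q - 1) q (relSub q) ≫ inrX (inr ψ) q -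
    ψ.f (q - 1) ≫ inlX (inr ψ) (q - 1) q (relSub q)) ≫
    sndX (inr ψ) q ≫ fstX ψ q (q - 1) (relSub q) = 𝟙 _
  simp

open homotopyCofiber in
/-- The contracting homotopy. -/
noncomputable def hC : Homotopy (𝟙 _) (rC ψ ≫ sC ψ) where
  hom i j := if hij : (ComplexShape.down ℤ).Rel j i then
    sndX (inr ψ) i ≫ sndX ψ i ≫ inlX (inr ψ) i j hij else 0
  zero i j hij := dif_neg hij
  comm q := by
    rw [dNext_eq _ (relSub q), prevD_eq _ (relAdd q), dif_pos (relSub q), dif_pos (relAdd q)]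
    change 𝟙 (homotopyCofiber.X (inr ψ) q) =
      homotopyCofiber.d (inr ψ) q (q - 1) ≫ (sndX (inr ψ) (q - 1) ≫ sndX ψ (q - 1) ≫
        inlX (inr ψ) (q - 1) q (relSub q)) +
      (sndX (inr ψ) q ≫ sndX ψ q ≫ inlX (inr ψ) q (q + 1) (relAdd q)) ≫
        homotopyCofiber.d (inr ψ) (q + 1) q +
      (sndX (inr ψ) q ≫ fstX ψ q (q - 1) (relSub q)) ≫
      (inlX ψ (q - 1) q (relSub q) ≫ inrX (inr ψ) q -
        ψ.f (q - 1) ≫ inlX (inr ψ) (q - 1) q (relSub q))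
    apply ext_from_X (inr ψ) (q - 1) q (relSub q)
    · simp [d_sndX_assoc _ _ _ (relSub q)]
    · apply ext_from_X ψ (q - 1) q (relSub q)
      · simp [d_sndX_assoc _ _ _ (relSub q)]
      · simp [inlX_d _ (q+1) q (q-1) (relAdd q) (relSub q)]

/-- The homology of the cone of `inr ψ`. -/
noncomputable def coneInrIso (q : ℤ) :
    (homotopyCofiber (homotopyCofiber.inr ψ)).homology q ≅ (shC W).homology q :=
  HomotopyEquiv.toHomologyIso ⟨rC ψ, sC ψ, (hC ψ).symm, Homotopy.ofEq (sC_rC ψ)⟩ q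

theorem exists_W (n : ℤ) {P₁ P₀ : ModuleCat.{u} A} (a : P₁ ⟶ P₀) :
    ∃ (W : ChainComplex (ModuleCat.{u} A) ℤ) (e₀ : ∀ j : ℤ, j + 1 = n → (P₀ ≅ W.X j))
      (e₁ : ∀ j : ℤ, j = n → (P₁ ≅ W.X j)),
      (∀ i j hi hj, (e₁ i hi).hom ≫ W.d i j = a ≫ (e₀ j hj).hom) ∧
      ∀ j : ℤ, j ≠ n → j + 1 ≠ n → IsZero (W.X j) := by
  have hne : n ≠ n - 1 := by omega
  refine ⟨double a (relSub n), fun j hj => ?_, fun j hj => ?_, ?_, ?_⟩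
  · have hj' : j = n - 1 := by omega
    subst hj'
    exact (doubleXIso₁ a (relSub n) hne).symm
  · subst hj
    exact (doubleXIso₀ a (relSub j)).symm
  · intro i j hi hj
    subst hi
    obtain rfl : j = i - 1 := by omega
    simp [double_d _ _ hne]
  · intro j h0 h1
    exact isZero_double_X _ _ _ h0 (by omega)

theorem exists_psi (n : ℤ) {P₁ P₀ : ModuleCat.{u} A} (a : P₁ ⟶ P₀)
    (W : ChainComplex (ModuleCat.{u} A) ℤ) (e₀ : ∀ j : ℤ, j + 1 = n → (P₀ ≅ W.X j))
    (e₁ : ∀ j : ℤ, j = n → (P₁ ≅ W.X j))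
    (he : ∀ i j hi hj, (e₁ i hi).hom ≫ W.d i j = a ≫ (e₀ j hj).hom)
    (hW : ∀ j : ℤ, j ≠ n → j + 1 ≠ n → IsZero (W.X j))
    (X Y : ChainComplex (ModuleCat.{u} A) ℤ) (f : X ⟶ Y)
    (ψ₀ : P₀ ⟶ X.X (n - 1)) (ψ₁ : P₁ ⟶ X.X n) (h₀ : P₀ ⟶ Y.X n) (h₁ : P₁ ⟶ Y.X (n + 1))
    (c₀ : ψ₀ ≫ X.d (n - 1) (n - 1 - 1) = 0)
    (c₁ : ψ₁ ≫ X.d n (n - 1) = a ≫ ψ₀)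
    (c₂ : ψ₀ ≫ f.f (n - 1) = h₀ ≫ Y.d n (n - 1))
    (c₃ : ψ₁ ≫ f.f n = a ≫ h₀ + h₁ ≫ Y.d (n + 1) n) :
    ∃ (ψ : W ⟶ X) (h : Homotopy (ψ ≫ f) 0),
      (e₀ (n - 1) (by omega)).hom ≫ ψ.f (n - 1) = ψ₀ ∧
      (e₀ (n - 1) (by omega)).hom ≫ h.hom (n - 1) n = h₀ := by
  have hne : n ≠ n - 1 := by omega
  have hne' : n - 1 ≠ n := by omega
  let F : ∀ j, W.X j ⟶ X.X j := fun j =>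
    if hj : j = n - 1 then (e₀ j (by omega)).inv ≫ ψ₀ ≫ eqToHom (by rw [hj])
    else if hj : j = n then (e₁ j hj).inv ≫ ψ₁ ≫ eqToHom (by rw [hj])
    else 0
  have F0 : F (n - 1) = (e₀ (n - 1) (by omega)).inv ≫ ψ₀ := by simp [F]
  have F1 : F n = (e₁ n rfl).inv ≫ ψ₁ := by simp [F, hne]
  have hd : ∀ j : ℤ, W.d (n - 1) j = 0 := by
    intro j
    by_cases hj : (ComplexShape.down ℤ).Rel (n - 1) j
    · simp at hj
      exact (hW j (by omega) (by omega)).eq_of_tgt _ _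
    · exact W.shape _ _ hj
  let ψ : W ⟶ X :=
    { f := F
      comm' := by
        intro i j hij
        obtain rfl : j = i - 1 := by simp at hij; omega
        by_cases h1 : i = n
        · subst h1
          rw [F0, F1, ← cancel_epi (e₁ i rfl).hom, ← Category.assoc _ (W.d _ _),
            he i (i - 1) rfl (by omega)]
          simp [c₁]
        · by_cases h2 : i = n - 1
          · subst h2
            rw [F0, hd, zero_comp, Category.assoc, c₀, comp_zero]
          · exact (hW i h1 (by omega)).eq_of_src _ _ }
  let H : ∀ i j, W.X i ⟶ Y.X j := fun i j =>
    if hj : i = n - 1 ∧ j = n then (e₀ i (by omega)).inv ≫ h₀ ≫ eqToHom (by rw [hj.2])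
    else if hj : i = n ∧ j = n + 1 then (e₁ i hj.1).inv ≫ h₁ ≫ eqToHom (by rw [hj.2])
    else 0
  have H0 : H (n - 1) n = (e₀ (n - 1) (by omega)).inv ≫ h₀ := by simp [H]
  have H1 : H n (n + 1) = (e₁ n rfl).inv ≫ h₁ := by simp [H, hne]
  let h : Homotopy (ψ ≫ f) 0 :=
    { hom := H
      zero := by
        intro i j hij
        have a1 : ¬ (i = n - 1 ∧ j = n) := by
          rintro ⟨rfl, rfl⟩; simp at hij
        have a2 : ¬ (i = n ∧ j = n + 1) := by
          rintro ⟨rfl, rfl⟩; simp at hij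
        simp only [H, dif_neg a1, dif_neg a2]
      comm := by
        intro i
        rw [dNext_eq _ (relSub i), prevD_eq _ (relAdd i)]
        change F i ≫ f.f i = W.d i (i - 1) ≫ H (i - 1) i + H i (i + 1) ≫ Y.d (i + 1) i + 0
        by_cases h1 : i = n
        · subst h1
          rw [F1, H0, H1, ← cancel_epi (e₁ i rfl).hom, add_zero, Preadditive.comp_add,
            ← Category.assoc _ (W.d _ _), he i (i - 1) rfl (by omega)]
          simp [c₃]
        · by_cases h2 : i = n - 1
          · have h3 : n = i + 1 := by omega
            subst h3
            have key : ∀ m, m = i + 1 - 1 → F m ≫ f.f m = H m (i + 1) ≫ Y.d (i + 1) m := by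
              rintro m rfl
              rw [F0, H0]; simp [c₂]
            have hd' : ∀ m, m = i + 1 - 1 → ∀ j, W.d m j = 0 := by
              rintro m rfl; exact hd
            rw [key i h2, hd' i h2]; simp
          · exact (hW i h1 (by omega)).eq_of_src _ _ }
  refine ⟨ψ, h, ?_, ?_⟩
  · change _ ≫ F (n - 1) = _
    rw [F0]; simp
  · change _ ≫ H (n - 1) n = _
    rw [H0]; simp

theorem exists_data (n : ℤ) {P₁ P₀ P : ModuleCat.{u} A} [Projective P₀] [Projective P₁]
    (a : P₁ ⟶ P₀) (p : P₀ ⟶ P) (w : a ≫ p = 0)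
    {X Y : ChainComplex (ModuleCat.{u} A) ℤ} (f : X ⟶ Y)
    (k : P ⟶ (homotopyCofiber f).homology n) :
    ∃ (c : P₀ ⟶ (homotopyCofiber f).cycles n) (z₁ : P₁ ⟶ (homotopyCofiber f).X (n + 1)),
      c ≫ (homotopyCofiber f).homologyπ n = p ≫ k ∧
      z₁ ≫ (homotopyCofiber f).d (n + 1) n = a ≫ c ≫ (homotopyCofiber f).iCycles n := by
  let C := homotopyCofiber f
  let c : P₀ ⟶ C.cycles n := Projective.factorThru (p ≫ k) (C.homologyπ n)
  have hc : c ≫ C.homologyπ n = p ≫ k := Projective.factorThru_comp _ _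
  have ex : (ShortComplex.mk (C.toCycles (n + 1) n) (C.homologyπ n) (by simp)).Exact :=
    ShortComplex.exact_of_g_is_cokernel _
      (C.homologyIsCokernel (n + 1) n ((ComplexShape.down ℤ).prev_eq' (relAdd n)))
  have hz : (a ≫ c) ≫ C.homologyπ n = 0 := by
    rw [Category.assoc, hc, ← Category.assoc, w, zero_comp]
  refine ⟨c, ex.liftFromProjective (a ≫ c) hz, hc, ?_⟩
  have := ex.liftFromProjective_comp (a ≫ c) hz
  change _ ≫ C.toCycles (n + 1) n = _ at this
  rw [← C.toCycles_i (n + 1) n, ← Category.assoc, this, Category.assoc]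

theorem W_exact (n : ℤ) {P₁ P₀ : ModuleCat.{u} A} (a : P₁ ⟶ P₀) [Mono a]
    (W : ChainComplex (ModuleCat.{u} A) ℤ) (e₀ : ∀ j : ℤ, j + 1 = n → (P₀ ≅ W.X j))
    (e₁ : ∀ j : ℤ, j = n → (P₁ ≅ W.X j))
    (he : ∀ i j hi hj, (e₁ i hi).hom ≫ W.d i j = a ≫ (e₀ j hj).hom)
    (hW : ∀ j : ℤ, j ≠ n → j + 1 ≠ n → IsZero (W.X j)) (j : ℤ) (hj : j + 1 ≠ n) :
    IsZero (W.homology j) := by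
  rw [← exactAt_iff_isZero_homology, W.exactAt_iff' (j + 1) j (j - 1) (by simp) (by simp)]
  by_cases h : j = n
  · subst h
    rw [ShortComplex.exact_iff_mono _ ((hW (j + 1) (by omega) (by omega)).eq_of_src _ _)]
    change Mono (W.d j (j - 1))
    have : W.d j (j - 1) = (e₁ j rfl).inv ≫ a ≫ (e₀ (j - 1) (by omega)).hom := by
      rw [← he j (j - 1) rfl]; simp
    rw [this]; infer_instance
  · exact ShortComplex.exact_of_isZero_X₂ _ (hW j h hj)

open homotopyCofiber in
theorem inl_inl_r {q j l : ℤ} (hq : (ComplexShape.down ℤ).Rel q l)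
    (hl : (ComplexShape.down ℤ).Rel l j) {P₀ : ModuleCat.{u} A} {n : ℤ}
    (e₀ : ∀ j : ℤ, j + 1 = n → (P₀ ≅ W.X j)) (hj : j + 1 = n) :
    ((e₀ j hj).hom ≫ inlX ψ j l hl ≫ inlX (desc ψ f h) l q hq) ≫ (coneSC ψ f h).g.f q =
      (e₀ (q - 1 - 1) (by simp at hq hl; omega)).hom := by
  obtain rfl : l = q - 1 := by simp at hq; omega
  obtain rfl : j = q - 1 - 1 := by simp at hl; omega
  change ((e₀ _ hj).hom ≫ inlX ψ _ _ _ ≫ inlX (desc ψ f h) _ q hq) ≫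
    fstX (desc ψ f h) q (q - 1) (relSub q) ≫ fstX ψ (q - 1) (q - 1 - 1) (relSub _) = _
  simp

theorem lift_neg_pi (C : ChainComplex (ModuleCat.{u} A) ℤ) (n k : ℤ) {P₀ : ModuleCat.{u} A}
    (c : P₀ ⟶ C.cycles n) (hk : (ComplexShape.down ℤ).next n = k)
    (h0 : (-(c ≫ C.iCycles n)) ≫ C.d n k = 0) :
    C.liftCycles (-(c ≫ C.iCycles n)) k hk h0 ≫ C.homologyπ n = -(c ≫ C.homologyπ n) := by
  have : C.liftCycles (-(c ≫ C.iCycles n)) k hk h0 = - c := by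
    rw [← cancel_mono (C.iCycles n)]
    simp
  rw [this, Preadditive.neg_comp]

theorem les_conclusion (S : ShortComplex (ChainComplex (ModuleCat.{u} A) ℤ)) (hS : S.ShortExact)
    (n : ℤ) (hT : ∀ q : ℤ, q ≠ n + 1 → IsZero (S.X₃.homology q)) {P : ModuleCat.{u} A}
    (eT : P ≅ S.X₃.homology (n + 1)) (k : P ⟶ S.X₁.homology n) [Epi k]
    (hδ : eT.hom ≫ hS.δ (n + 1) n (relAdd n) = - k) :
    IsZero (S.X₂.homology n) ∧
    (∀ q : ℤ, q ≠ n → q ≠ n + 1 → Nonempty (S.X₂.homology q ≅ S.X₁.homology q)) ∧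
    ∃ (α : S.X₁.homology (n + 1) →ₗ[A] S.X₂.homology (n + 1))
      (β : S.X₂.homology (n + 1) →ₗ[A] LinearMap.ker k.hom),
      Function.Injective α ∧ Function.Surjective β ∧ LinearMap.range α = LinearMap.ker β := by
  refine ⟨?_, ?_, ?_⟩
  · have hepi : Epi (HomologicalComplex.homologyMap S.f n) :=
      (hS.homology_exact₂ n).epi_f ((hT n (by omega)).eq_of_tgt _ _)
    have hepi2 : Epi (hS.δ (n + 1) n (relAdd _)) := by
      have : Epi (eT.hom ≫ hS.δ (n + 1) n (relAdd _)) := by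
        rw [hδ]
        have h3 : - k = k ≫ (negIso _).hom := by simp [negIso]
        rw [h3]; infer_instance
      exact epi_of_epi eT.hom _
    have h0 : HomologicalComplex.homologyMap S.f n = 0 := by
      rw [← cancel_epi (hS.δ (n + 1) n (relAdd _)), hS.δ_comp, comp_zero]
    exact IsZero.of_epi_eq_zero _ h0
  · intro q h1 h2
    have hepi : Epi (HomologicalComplex.homologyMap S.f q) :=
      (hS.homology_exact₂ q).epi_f ((hT q (by omega)).eq_of_tgt _ _)
    have hmono : Mono (HomologicalComplex.homologyMap S.f q) :=
      (hS.homology_exact₁ (q + 1) q (relAdd _)).mono_g ((hT (q + 1) (by omega)).eq_of_src _ _)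
    have := isIso_of_mono_of_epi (HomologicalComplex.homologyMap S.f q)
    exact ⟨(asIso (HomologicalComplex.homologyMap S.f q)).symm⟩
  · let a := HomologicalComplex.homologyMap S.f (n + 1)
    let b := HomologicalComplex.homologyMap S.g (n + 1)
    have hmono : Mono a :=
      (hS.homology_exact₁ (n + 1 + 1) (n + 1) (relAdd _)).mono_g
        ((hT (n + 1 + 1) (by omega)).eq_of_src _ _)
    have hk' : k = - (eT.hom ≫ hS.δ (n + 1) n (relAdd _)) := by
      rw [hδ, neg_neg]
    have hmem : (b ≫ eT.inv) ≫ k = 0 := by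
      rw [hk']
      simp [b]
    refine ⟨a.hom, LinearMap.codRestrict (LinearMap.ker k.hom) (b ≫ eT.inv).hom
      (fun x => ConcreteCategory.congr_hom hmem x), ?_, ?_, ?_⟩
    · exact (ModuleCat.mono_iff_injective a).1 hmono
    · rintro ⟨y, hy⟩
      have hy' : (hS.δ (n + 1) n (relAdd _)) (eT.hom y) = 0 := by
        have := ConcreteCategory.congr_hom hδ y
        refine this.trans ?_
        change - (k.hom y) = 0
        rw [LinearMap.mem_ker.1 hy, neg_zero]
      obtain ⟨x, hx⟩ := (ShortComplex.moduleCat_exact_iff _).1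
        (hS.homology_exact₃ (n + 1) n (relAdd _)) (eT.hom y) hy'
      refine ⟨x, Subtype.ext ?_⟩
      change eT.inv (b x) = y
      have hx' : b x = eT.hom y := hx
      rw [hx']
      exact ConcreteCategory.congr_hom eT.hom_inv_id y
    · refine Eq.trans ?_ (LinearMap.ker_codRestrict _ _ _).symm
      have h1 := (hS.homology_exact₂ (n + 1)).moduleCat_range_eq_ker
      refine h1.trans ?_
      ext x
      change b x = 0 ↔ eT.inv (b x) = 0
      constructor
      · intro hx
        rw [hx, map_zero]
      · intro hx
        have := ConcreteCategory.congr_hom eT.inv_hom_id (b x)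
        refine this.symm.trans ?_
        change eT.hom (eT.inv (b x)) = 0
        rw [hx, map_zero]

open homotopyCofiber in
theorem delta_eq (n : ℤ) {P₀ : ModuleCat.{u} A} (e₀ : ∀ j : ℤ, j + 1 = n → (P₀ ≅ W.X j))
    (hd : W.d (n - 1) (n - 1 - 1) = 0)
    (c : P₀ ⟶ (homotopyCofiber f).cycles n)
    (hψ : (e₀ (n - 1) (by omega)).hom ≫ ψ.f (n - 1) =
      (c ≫ (homotopyCofiber f).iCycles n) ≫ fstX f n (n - 1) (relSub n))
    (hh : (e₀ (n - 1) (by omega)).hom ≫ h.hom (n - 1) n =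
      - (c ≫ (homotopyCofiber f).iCycles n) ≫ sndX f n)
    (hx : (e₀ (n + 1 - 1 - 1) (by omega)).hom ≫ (coneSC ψ f h).X₃.d (n + 1) n = 0) :
    (coneSC ψ f h).X₃.liftCycles (e₀ (n + 1 - 1 - 1) (by omega)).hom n (by simp) hx ≫
      (coneSC ψ f h).X₃.homologyπ (n + 1) ≫ (coneSC_shortExact ψ f h).δ (n + 1) n (relAdd n) =
      - (c ≫ (homotopyCofiber f).homologyπ n) := by
  refine ((coneSC_shortExact ψ f h).δ_eq (n + 1) n (relAdd n) _ hx
    ((e₀ (n - 1) (by omega)).hom ≫ inlX ψ (n - 1) n (relSub n) ≫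
      inlX (desc ψ f h) n (n + 1) (relAdd n)) (inl_inl_r ψ f h _ _ e₀ _)
    (- (c ≫ (homotopyCofiber f).iCycles n)) ?_ (n - 1) (by simp)).trans ?_
  · generalize c ≫ (homotopyCofiber f).iCycles n = z at *
    change (-z) ≫ (fstX f n (n - 1) (relSub n) ≫ inrX ψ (n - 1) ≫
      inlX (desc ψ f h) (n - 1) n (relSub n) + sndX f n ≫ inrX (desc ψ f h) n) =
      ((e₀ (n - 1) (by omega)).hom ≫ inlX ψ (n - 1) n (relSub n) ≫
      inlX (desc ψ f h) n (n + 1) (relAdd n)) ≫ homotopyCofiber.d (desc ψ f h) (n + 1) n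
    have h1 := hψ =≫ (inrX ψ (n - 1) ≫ inlX (desc ψ f h) (n - 1) n (relSub n))
    have h2 := hh =≫ (inrX (desc ψ f h) n)
    simp only [Category.assoc, Preadditive.neg_comp] at h1 h2
    simp [inlX_d (desc ψ f h) (n+1) n (n-1) (relAdd _) (relSub _),
      inlX_d_assoc ψ n (n-1) (n-1-1) (relSub _) (relSub _), hd, h1, h2]
  · exact lift_neg_pi (homotopyCofiber f) n (n - 1) c _ _

end helpers

/-- Killing a relative homology class using a module `P` with a length-one
projective resolution `0 → P₁ → P₀ → P → 0`.  Given `f : X ⟶ Y` and a surjection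
`k : P ↠ H_n(cone f)`, there is a factorization `X ⟶ X′ ⟶ Y` with `X′_q = X_q` for
`q ∉ {n, n+1}`, `X′_n = X_n ⊕ P₀`, `X′_{n+1} = X_{n+1} ⊕ P₁`, such that `H_*(cone i)` is
`P` concentrated in degree `n`, `H_n(cone g) = 0`, `H_q(cone g) ≅ H_q(cone f)` for
`q ∉ {n, n+1}`, and `0 → H_{n+1}(cone f) → H_{n+1}(cone g) → ker k → 0` is exact. -/
theorem stmt9 {A : Type u} [Ring A]
    (X Y : ChainComplex (ModuleCat.{u} A) ℤ)
    (hX : ∀ q : ℤ, q < 0 → IsZero (X.X q)) (hY : ∀ q : ℤ, q < 0 → IsZero (Y.X q))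
    (f : X ⟶ Y)
    (P P₀ P₁ : Type u)
    [AddCommGroup P] [Module A P]
    [AddCommGroup P₀] [Module A P₀] [Module.Projective A P₀]
    [AddCommGroup P₁] [Module A P₁] [Module.Projective A P₁]
    (ι : P₁ →ₗ[A] P₀) (π : P₀ →ₗ[A] P)
    (hι : Function.Injective ι) (hπ : Function.Surjective π)
    (hexact : LinearMap.range ι = LinearMap.ker π)
    (n : ℕ)
    (k : P →ₗ[A] ↥((Cone f).homology (n : ℤ)))
    (hk : Function.Surjective k) :
    ∃ (X' : ChainComplex (ModuleCat.{u} A) ℤ) (i : X ⟶ X') (g : X' ⟶ Y),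
      (∀ q : ℤ, q < 0 → IsZero (X'.X q)) ∧
      (∀ q : ℤ, q ≠ (n : ℤ) → q ≠ (n : ℤ) + 1 →
        ∃ e : X'.X q ≅ X.X q, i.f q ≫ e.hom = 𝟙 (X.X q)) ∧
      (∃ e : X'.X (n : ℤ) ≅ (X.X (n : ℤ)) ⊞ (ModuleCat.of A P₀),
        i.f (n : ℤ) ≫ e.hom = biprod.inl) ∧
      (∃ e : X'.X ((n : ℤ) + 1) ≅ (X.X ((n : ℤ) + 1)) ⊞ (ModuleCat.of A P₁),
        i.f ((n : ℤ) + 1) ≫ e.hom = biprod.inl) ∧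
      i ≫ g = f ∧
      (∀ q : ℤ, q ≠ (n : ℤ) → IsZero ((Cone i).homology q)) ∧
      Nonempty ((Cone i).homology (n : ℤ) ≅ ModuleCat.of A P) ∧
      IsZero ((Cone g).homology (n : ℤ)) ∧
      (∀ q : ℤ, q ≠ (n : ℤ) → q ≠ (n : ℤ) + 1 →
        Nonempty ((Cone g).homology q ≅ (Cone f).homology q)) ∧
      ∃ (α : ↥((Cone f).homology ((n : ℤ) + 1)) →ₗ[A] ↥((Cone g).homology ((n : ℤ) + 1)))
        (β : ↥((Cone g).homology ((n : ℤ) + 1)) →ₗ[A] ↥(LinearMap.ker k)),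
        Function.Injective α ∧ Function.Surjective β ∧
          LinearMap.range α = LinearMap.ker β := by
  have ew : ModuleCat.ofHom ι ≫ ModuleCat.ofHom π = 0 := by
    ext x
    have : ι x ∈ LinearMap.ker π := hexact ▸ ⟨x, rfl⟩
    simpa using this
  have ex : (ShortComplex.mk (ModuleCat.ofHom ι) (ModuleCat.ofHom π) ew).Exact :=
    ShortComplex.Exact.moduleCat_of_range_eq_ker _ _ hexact
  have : Epi (ModuleCat.ofHom π) := (ModuleCat.epi_iff_surjective _).2 hπ
  have : Mono (ModuleCat.ofHom ι) := (ModuleCat.mono_iff_injective _).2 hι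
  have : Projective (ModuleCat.of A P₀) := (IsProjective.iff_projective _).1 inferInstance
  have : Projective (ModuleCat.of A P₁) := (IsProjective.iff_projective _).1 inferInstance
  have hkepi : Epi (ModuleCat.ofHom k) := (ModuleCat.epi_iff_surjective _).2 hk
  obtain ⟨W, e₀, e₁, he, hW⟩ := exists_W (n : ℤ) (ModuleCat.ofHom ι)
  obtain ⟨c, z₁, hc, hz₁⟩ := exists_data (n : ℤ) (ModuleCat.ofHom ι) (ModuleCat.ofHom π) ew f
    (ModuleCat.ofHom k)
  have hdW : ∀ i j : ℤ, i + 1 = n → W.d i j = 0 := by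
    intro i j hi
    by_cases hij : (ComplexShape.down ℤ).Rel i j
    · simp at hij
      exact (hW j (by omega) (by omega)).eq_of_tgt _ _
    · exact W.shape _ _ hij
  obtain ⟨ψ, h, hψ, hh⟩ := exists_psi (n : ℤ) (ModuleCat.ofHom ι) W e₀ e₁ he hW X Y f
    ((c ≫ (homotopyCofiber f).iCycles n) ≫ homotopyCofiber.fstX f n (n - 1) (relSub n))
    (- z₁ ≫ homotopyCofiber.fstX f (n + 1) n (relAdd n))
    (- (c ≫ (homotopyCofiber f).iCycles n) ≫ homotopyCofiber.sndX f n)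
    (z₁ ≫ homotopyCofiber.sndX f (n + 1))
    (by
      have h1 := (homotopyCofiber f).iCycles_d n ((n : ℤ) - 1) =≫
        homotopyCofiber.fstX f (n - 1) (n - 1 - 1) (relSub _)
      erw [Category.assoc, homotopyCofiber.d_fstX f _ _ _ (relSub _) (relSub _), zero_comp] at h1
      rw [Preadditive.comp_neg, neg_eq_zero] at h1
      rw [Category.assoc, Category.assoc, h1, comp_zero])
    (by
      have h1 := hz₁ =≫ homotopyCofiber.fstX f n (n - 1) (relSub _)
      erw [Category.assoc, homotopyCofiber.d_fstX f _ _ _ (relAdd _) (relSub _)] at h1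
      simpa using h1)
    (by
      have h1 := (homotopyCofiber f).iCycles_d n ((n : ℤ) - 1) =≫
        homotopyCofiber.sndX f (n - 1)
      erw [Category.assoc, homotopyCofiber.d_sndX f _ _ (relSub _), zero_comp] at h1
      rw [Preadditive.comp_add, add_eq_zero_iff_eq_neg] at h1
      simp [h1])
    (by
      have h1 := hz₁ =≫ homotopyCofiber.sndX f n
      erw [Category.assoc, homotopyCofiber.d_sndX f _ _ (relAdd _)] at h1
      rw [Preadditive.comp_add, add_comm, ← eq_sub_iff_add_eq] at h1
      simp [h1]
      try abel)
  have hWex := W_exact (n : ℤ) (ModuleCat.ofHom ι) W e₀ e₁ he hW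
  have hSh : ∀ q : ℤ, q ≠ n → IsZero ((shC W).homology q) := fun q hq =>
    (hWex (q - 1) (by omega)).of_iso (shHomologyIso W q)
  have hT : ∀ q : ℤ, q ≠ n + 1 → IsZero ((coneSC ψ f h).X₃.homology q) := fun q hq =>
    (hSh (q - 1) (by omega)).of_iso (shHomologyIso (shC W) q)
  obtain ⟨eQ, -⟩ := augIso (shC W) (n : ℤ) (n - 1) (relSub _) (ModuleCat.ofHom ι)
    (ModuleCat.ofHom π) ew ex (e₀ (n - 1) (by omega))
    ((e₁ (n + 1 - 1) (by omega)) ≪≫ negIso _)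
    (by
      change - W.d _ _ = 0
      rw [hdW _ _ (by omega), neg_zero])
    (by
      change ((e₁ (n + 1 - 1) (by omega)).hom ≫ (- 𝟙 (W.X (n + 1 - 1)))) ≫ (- W.d (n + 1 - 1) (n - 1)) = _
      refine Eq.trans ?_ (he (n + 1 - 1) (n - 1) (by omega) (by omega))
      simp)
  have hdT : (coneSC ψ f h).X₃.d (n + 1) n = 0 := by
    change - - W.d _ _ = 0
    rw [hdW _ _ (by omega), neg_zero, neg_zero]
  obtain ⟨eT, heT⟩ := augIso (coneSC ψ f h).X₃ ((n : ℤ) + 1) n (relAdd _) (ModuleCat.ofHom ι)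
    (ModuleCat.ofHom π) ew ex (e₀ (n + 1 - 1 - 1) (by omega))
    (e₁ (n + 1 + 1 - 1 - 1) (by omega)) hdT
    (by
      change (e₁ (n + 1 + 1 - 1 - 1) (by omega)).hom ≫ (- - W.d (n + 1 + 1 - 1 - 1) (n + 1 - 1 - 1)) = _
      refine Eq.trans ?_ (he (n + 1 + 1 - 1 - 1) (n + 1 - 1 - 1) (by omega) (by omega))
      rw [neg_neg])
  have hS := coneSC_shortExact ψ f h
  let k' : ModuleCat.of A P ⟶ (coneSC ψ f h).X₁.homology (n : ℤ) := ModuleCat.ofHom k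
  have hδ : eT.hom ≫ hS.δ (n + 1) n (relAdd _) = - k' := by
    refine (cancel_epi (ModuleCat.ofHom π)).1 ?_
    refine (Category.assoc _ _ _).symm.trans ((heT =≫ hS.δ (n + 1) n (relAdd _)).trans
      ((Category.assoc _ _ _).trans
        ((delta_eq ψ f h (n : ℤ) e₀ (hdW _ _ (by omega)) c hψ hh _).trans ?_)))
    exact (congrArg Neg.neg hc).trans (Preadditive.comp_neg _ _).symm
  have : Epi k' := hkepi
  refine ⟨homotopyCofiber ψ, homotopyCofiber.inr ψ, homotopyCofiber.desc ψ f h, ?_, ?_, ?_, ?_,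
    homotopyCofiber.inr_desc ψ f h, ?_, ?_,
    les_conclusion (coneSC ψ f h) hS n hT eT k' hδ⟩
  · intro q hq
    exact homotopyCofiber.isZero_X ψ _ (hX q hq) (fun j hj => by
      simp at hj
      exact hW j (by omega) (by omega))
  · intro q h1 h2
    refine ⟨⟨homotopyCofiber.sndX ψ q, homotopyCofiber.inrX ψ q, ?_, ?_⟩, ?_⟩
    · apply homotopyCofiber.ext_from_X ψ (q - 1) q (relSub q)
      · exact (hW _ (by omega) (by omega)).eq_of_src _ _
      · simp
    · simp
    · exact homotopyCofiber.inrX_sndX ψ q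
  · refine ⟨homotopyCofiber.XIsoBiprod ψ n (n - 1) (relSub _) ≪≫ biprod.braiding _ _ ≪≫
      biprod.mapIso (Iso.refl _) (e₀ (n - 1) (by omega)).symm, ?_⟩
    change homotopyCofiber.inrX ψ n ≫ _ = _
    apply biprod.hom_ext <;> simp
  · refine ⟨homotopyCofiber.XIsoBiprod ψ (n + 1) n (relAdd _) ≪≫ biprod.braiding _ _ ≪≫
      biprod.mapIso (Iso.refl _) (e₁ n rfl).symm, ?_⟩
    change homotopyCofiber.inrX ψ (n + 1) ≫ _ = _
    apply biprod.hom_ext <;> simp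
  · intro q hq
    exact (hSh q hq).of_iso (coneInrIso ψ q)
  · exact ⟨coneInrIso ψ n ≪≫ eQ.symm⟩
end

section
/- Let A be a ring and f : X → Y a map of bounded nonnegatively graded chain complexes of finitely generated projective A-modules which is m-connected, i.e. H_q(cone f) = 0 for all q ≤ m. Then there exist an integer n ≥ m, chain complexes Z_m = X, Z_{m+1}, …, Z_n, chain maps Z_{q−1} → Z_q for m < q ≤ n, and a chain map Z_n → Y, such that the composite Z_m → Z_{m+1} → ⋯ → Z_n → Y equals f, the map Z_n → Y is a quasi-isomorphism, and for each q with m < q ≤ n the homology of cone(Z_{q−1} → Z_q) vanishes in all degrees except q, where it is a finitely generated projective A-module. -/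
open CategoryTheory Limits

universe u

/-- The composite `Z 0 ⟶ Z N` of a chain of maps `Z j ⟶ Z (j+1)`. -/
noncomputable def compChain {A : Type u} [Ring A]
    (Z : ℕ → ChainComplex (ModuleCat.{u} A) ℤ) (φ : ∀ j, Z j ⟶ Z (j + 1)) :
    ∀ N, Z 0 ⟶ Z N
  | 0 => 𝟙 _
  | (N + 1) => compChain Z φ N ≫ φ N

namespace Aux

section generic

variable {A : Type u} [Ring A]

lemma isZero_homology_iff (C : ChainComplex (ModuleCat.{u} A) ℤ) (i j k : ℤ) (hi : j + 1 = i)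
    (hk : k + 1 = j) : IsZero (C.homology j) ↔
      ∀ x : C.X j, (C.d j k).hom x = 0 → ∃ y : C.X i, (C.d i j).hom y = x := by
  rw [← HomologicalComplex.exactAt_iff_isZero_homology,
    HomologicalComplex.exactAt_iff' C i j k ((ComplexShape.down ℤ).prev_eq' hi)
      ((ComplexShape.down ℤ).next_eq' hk), ShortComplex.moduleCat_exact_iff]
  rfl

lemma homology_fgp (C : ChainComplex (ModuleCat.{u} A) ℤ) (i j k : ℤ) (hi : j + 1 = i)
    (hk : k + 1 = j) (P : Type u) [AddCommGroup P] [Module A P] [Module.Finite A P]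
    [Module.Projective A P] (r : C.X j →ₗ[A] P)
    (hr : ∀ p, ∃ x, (C.d j k).hom x = 0 ∧ r x = p)
    (hr0 : ∀ y, r ((C.d i j).hom y) = 0)
    (hr1 : ∀ x, (C.d j k).hom x = 0 → r x = 0 → ∃ y, (C.d i j).hom y = x) :
    Module.Finite A (C.homology j) ∧ Module.Projective A (C.homology j) := by
  let e1 : C.homology j ≅ _ := C.homologyIsoSc' i j k ((ComplexShape.down ℤ).prev_eq' hi)
      ((ComplexShape.down ℤ).next_eq' hk) ≪≫ (C.sc' i j k).moduleCatHomologyIso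
  let r' : LinearMap.ker (C.sc' i j k).g.hom →ₗ[A] P := r ∘ₗ (Submodule.subtype _)
  have hsurj : Function.Surjective r' := fun p => by
    obtain ⟨x, hx, rfl⟩ := hr p
    exact ⟨⟨x, hx⟩, rfl⟩
  have hker : LinearMap.range (C.sc' i j k).moduleCatToCycles = LinearMap.ker r' := by
    ext ⟨x, hx⟩
    constructor
    · rintro ⟨y, hy⟩
      have : (C.d i j).hom y = x := congrArg Subtype.val hy
      subst this
      exact hr0 y
    · intro h
      obtain ⟨y, hy⟩ := hr1 x hx h
      exact ⟨y, Subtype.ext hy⟩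
  let e2 : (LinearMap.ker (C.sc' i j k).g.hom ⧸
      LinearMap.range (C.sc' i j k).moduleCatToCycles) ≃ₗ[A] P :=
    (Submodule.quotEquivOfEq _ _ hker).trans (LinearMap.quotKerEquivOfSurjective r' hsurj)
  let e : P ≃ₗ[A] C.homology j := (e1.toLinearEquiv.trans e2).symm
  exact ⟨Module.Finite.equiv e, Module.Projective.of_equiv e⟩

lemma exists_cycle (C : ChainComplex (ModuleCat.{u} A) ℤ) (j k : ℤ) (hk : k + 1 = j) (x : C.X j)
    (hx : (C.d j k).hom x = 0) : ∃ z : C.cycles j, (C.iCycles j).hom z = x := by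
  let g : ModuleCat.of A (LinearMap.ker (C.d j k).hom) ⟶ C.X j :=
    ModuleCat.ofHom (Submodule.subtype _)
  have hg : g ≫ C.d j k = 0 := by
    ext ⟨y, hy⟩
    exact hy
  refine ⟨(C.liftCycles g k ((ComplexShape.down ℤ).next_eq' hk) hg).hom ⟨x, hx⟩, ?_⟩
  have := C.liftCycles_i g k ((ComplexShape.down ℤ).next_eq' hk) hg
  exact congr($(this).hom ⟨x, hx⟩)

lemma homologyπ_surj (C : ChainComplex (ModuleCat.{u} A) ℤ) (j : ℤ) :
    Function.Surjective (C.homologyπ j).hom :=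
  (ModuleCat.epi_iff_surjective _).1 inferInstance

lemma iCycles_inj (C : ChainComplex (ModuleCat.{u} A) ℤ) (j : ℤ) :
    Function.Injective (C.iCycles j).hom :=
  (ModuleCat.mono_iff_injective _).1 inferInstance

lemma homologyπ_eq_zero_iff (C : ChainComplex (ModuleCat.{u} A) ℤ) (i j : ℤ) (hi : j + 1 = i)
    (z : C.cycles j) :
    (C.homologyπ j).hom z = 0 ↔ ∃ y, (C.d i j).hom y = (C.iCycles j).hom z := by
  have hex := ShortComplex.exact_of_g_is_cokernel (ShortComplex.mk _ _ (C.toCycles_comp_homologyπ i j))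
    (C.homologyIsCokernel i j ((ComplexShape.down ℤ).prev_eq' hi))
  rw [ShortComplex.moduleCat_exact_iff] at hex
  have ht : ∀ y, (C.iCycles j).hom ((C.toCycles i j).hom y) = (C.d i j).hom y :=
    fun y => congr($(C.toCycles_i i j).hom y)
  constructor
  · intro h
    obtain ⟨y, hy⟩ := hex z h
    refine ⟨y, ?_⟩
    rw [← ht]
    exact congrArg _ hy
  · rintro ⟨y, hy⟩
    have : (C.toCycles i j).hom y = z := iCycles_inj C j (by rw [ht, hy])
    rw [← this]
    exact congr($(C.toCycles_comp_homologyπ i j).hom y)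

lemma d_iCycles (C : ChainComplex (ModuleCat.{u} A) ℤ) (j k : ℤ) (z : C.cycles j) :
    (C.d j k).hom ((C.iCycles j).hom z) = 0 := congr($(C.iCycles_d j k).hom z)

lemma quasiIso_of (K L : ChainComplex (ModuleCat.{u} A) ℤ) (g : K ⟶ L)
    (hinj : ∀ (i j k : ℤ), j + 1 = i → k + 1 = j → ∀ z : K.X j, (K.d j k).hom z = 0 →
      ∀ l : L.X i, (L.d i j).hom l = (g.f j).hom z → ∃ y : K.X i, (K.d i j).hom y = z)
    (hsurj : ∀ (i j k : ℤ), j + 1 = i → k + 1 = j → ∀ l : L.X j, (L.d j k).hom l = 0 →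
      ∃ (z : K.X j) (y : L.X i), (K.d j k).hom z = 0 ∧ (g.f j).hom z = l + (L.d i j).hom y) :
    QuasiIso g := by
  rw [quasiIso_iff]
  intro j
  rw [quasiIsoAt_iff_isIso_homologyMap, ConcreteCategory.isIso_iff_bijective]
  have hπ : ∀ z, (HomologicalComplex.homologyMap g j).hom ((K.homologyπ j).hom z) =
      (L.homologyπ j).hom ((HomologicalComplex.cyclesMap g j).hom z) :=
    fun z => congr($(HomologicalComplex.homologyπ_naturality g j).hom z)
  have hi : ∀ z, (L.iCycles j).hom ((HomologicalComplex.cyclesMap g j).hom z) =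
      (g.f j).hom ((K.iCycles j).hom z) :=
    fun z => congr($(HomologicalComplex.cyclesMap_i g j).hom z)
  constructor
  · refine (injective_iff_map_eq_zero (HomologicalComplex.homologyMap g j).hom).2 ?_
    intro a ha
    obtain ⟨z, rfl⟩ := homologyπ_surj K j a
    rw [hπ, homologyπ_eq_zero_iff L (j+1) j rfl] at ha
    obtain ⟨l, hl⟩ := ha
    rw [homologyπ_eq_zero_iff K (j+1) j rfl]
    exact hinj (j+1) j (j-1) rfl (by omega) _ (d_iCycles _ _ _ _) l (by rw [hl, hi])
  · intro a
    obtain ⟨w, rfl⟩ := homologyπ_surj L j a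
    obtain ⟨z, y, hz, hy⟩ := hsurj (j+1) j (j-1) rfl (by omega) _ (d_iCycles L j (j-1) w)
    obtain ⟨z', rfl⟩ := exists_cycle K j (j-1) (by omega) z hz
    refine ⟨(K.homologyπ j).hom z', ?_⟩
    refine (hπ z').trans ?_
    rw [← sub_eq_zero, ← map_sub, homologyπ_eq_zero_iff L (j+1) j rfl]
    exact ⟨y, by rw [map_sub, hi, hy]; abel⟩

end generic

section cone

variable {A : Type u} [Ring A] {X Y : ChainComplex (ModuleCat.{u} A) ℤ} (f : X ⟶ Y)

noncomputable def cfst (i j : ℤ) (h : j + 1 = i) : (Cone f).X i →ₗ[A] X.X j :=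
  (HomologicalComplex.homotopyCofiber.fstX f i j h).hom

noncomputable def csnd (i : ℤ) : (Cone f).X i →ₗ[A] Y.X i :=
  (HomologicalComplex.homotopyCofiber.sndX f i).hom

noncomputable def cinl (i j : ℤ) (h : j + 1 = i) : X.X j →ₗ[A] (Cone f).X i :=
  (HomologicalComplex.homotopyCofiber.inlX f j i h).hom

noncomputable def cinr (i : ℤ) : Y.X i →ₗ[A] (Cone f).X i :=
  (HomologicalComplex.homotopyCofiber.inrX f i).hom

@[simp] lemma cfst_cinl (i j : ℤ) (h : j + 1 = i) (x) : cfst f i j h (cinl f i j h x) = x :=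
  congr($(HomologicalComplex.homotopyCofiber.inlX_fstX f j i h).hom x)
@[simp] lemma csnd_cinl (i j : ℤ) (h : j + 1 = i) (x) : csnd f i (cinl f i j h x) = 0 :=
  congr($(HomologicalComplex.homotopyCofiber.inlX_sndX f j i h).hom x)
@[simp] lemma cfst_cinr (i j : ℤ) (h : j + 1 = i) (x) : cfst f i j h (cinr f i x) = 0 :=
  congr($(HomologicalComplex.homotopyCofiber.inrX_fstX f i j h).hom x)
@[simp] lemma csnd_cinr (i : ℤ) (x) : csnd f i (cinr f i x) = x :=
  congr($(HomologicalComplex.homotopyCofiber.inrX_sndX f i).hom x)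

lemma cone_eq (i j : ℤ) (h : j + 1 = i) (c : (Cone f).X i) :
    cinl f i j h (cfst f i j h c) + cinr f i (csnd f i c) = c := by
  have h' : (ComplexShape.down ℤ).Rel i j := h
  have : HomologicalComplex.homotopyCofiber.fstX f i j h' ≫
      HomologicalComplex.homotopyCofiber.inlX f j i h' +
      HomologicalComplex.homotopyCofiber.sndX f i ≫
      HomologicalComplex.homotopyCofiber.inrX f i = 𝟙 _ := by
    apply HomologicalComplex.homotopyCofiber.ext_from_X f j i h'
    · rw [Preadditive.comp_add, HomologicalComplex.homotopyCofiber.inlX_fstX_assoc,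
        HomologicalComplex.homotopyCofiber.inlX_sndX_assoc, Limits.zero_comp, add_zero,
        Category.comp_id]
    · rw [Preadditive.comp_add, HomologicalComplex.homotopyCofiber.inrX_fstX_assoc,
        HomologicalComplex.homotopyCofiber.inrX_sndX_assoc, Limits.zero_comp, zero_add,
        Category.comp_id]
  exact congr($(this).hom c)

lemma cone_ext (i j : ℤ) (h : j + 1 = i) {c c' : (Cone f).X i}
    (h1 : cfst f i j h c = cfst f i j h c') (h2 : csnd f i c = csnd f i c') : c = c' := by
  rw [← cone_eq f i j h c, h1, h2, cone_eq]

lemma cfst_d (i j k : ℤ) (hi : j + 1 = i) (hj : k + 1 = j) (c : (Cone f).X i) :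
    cfst f j k hj (((Cone f).d i j).hom c) = - (X.d j k).hom (cfst f i j hi c) :=
  congr($(HomologicalComplex.homotopyCofiber.d_fstX f i j k hi hj).hom c)

lemma csnd_d (i j : ℤ) (hi : j + 1 = i) (c : (Cone f).X i) :
    csnd f j (((Cone f).d i j).hom c) =
      (f.f j).hom (cfst f i j hi c) + (Y.d i j).hom (csnd f i c) :=
  congr($(HomologicalComplex.homotopyCofiber.d_sndX f i j hi).hom c)

noncomputable def coneEquiv (i j : ℤ) (h : j + 1 = i) :
    (X.X j × Y.X i) ≃ₗ[A] (Cone f).X i where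
  toFun p := cinl f i j h p.1 + cinr f i p.2
  invFun c := (cfst f i j h c, csnd f i c)
  map_add' p q := by simp only [Prod.fst_add, Prod.snd_add, map_add]; abel
  map_smul' a p := by simp
  left_inv p := by simp
  right_inv c := cone_eq f i j h c

lemma comm_apply {K L : ChainComplex (ModuleCat.{u} A) ℤ} (g : K ⟶ L) (i j : ℤ) (x : K.X i) :
    (L.d i j).hom ((g.f i).hom x) = (g.f j).hom ((K.d i j).hom x) :=
  congr($(g.comm i j).hom x)

lemma dd_apply (K : ChainComplex (ModuleCat.{u} A) ℤ) (i j k : ℤ) (x : K.X i) :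
    (K.d j k).hom ((K.d i j).hom x) = 0 :=
  congr($(K.d_comp_d i j k).hom x)

/-- cone of a degreewise injection that is an isomorphism away from degree `q`. -/
lemma cone_conc (q : ℤ) (hinj : ∀ i, Function.Injective (f.f i).hom)
    (hs : ∀ i, i ≠ q → Function.Surjective (f.f i).hom) (P : Type u) [AddCommGroup P] [Module A P]
    [Module.Finite A P] [Module.Projective A P] (r : Y.X q →ₗ[A] P) (hr : Function.Surjective r)
    (hk : ∀ y, r y = 0 ↔ ∃ x, (f.f q).hom x = y) :
    (∀ i, i ≠ q → IsZero ((Cone f).homology i)) ∧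
      Module.Finite A ((Cone f).homology q) ∧ Module.Projective A ((Cone f).homology q) := by
  have key : ∀ (i j k : ℤ) (hi : j + 1 = i) (hk : k + 1 = j) (c : (Cone f).X j)
      (x : X.X j), (f.f j).hom x = csnd f j c → ((Cone f).d j k).hom c = 0 →
      ∃ y, ((Cone f).d i j).hom y = c := by
    intro i j k hi hk c x hx hc
    refine ⟨cinl f i j hi x, cone_ext f j k hk ?_ ?_⟩
    · rw [cfst_d f i j k hi hk, cfst_cinl]
      have := csnd_d f j k hk c
      rw [hc, map_zero, ← hx, comm_apply, ← map_add] at this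
      have := (injective_iff_map_eq_zero _).1 (hinj k) _ this.symm
      rw [eq_comm, ← add_eq_zero_iff_eq_neg]
      exact this
    · rw [csnd_d f i j hi]
      simp [hx]
  refine ⟨fun i hi => ?_, ?_⟩
  · rw [isZero_homology_iff _ (i+1) i (i-1) rfl (by omega)]
    intro c hc
    obtain ⟨x, hx⟩ := hs i hi (csnd f i c)
    exact key _ _ _ rfl (by omega) c x hx hc
  · refine homology_fgp _ (q+1) q (q-1) rfl (by omega) P (r ∘ₗ csnd f q) ?_ ?_ ?_
    · intro p
      obtain ⟨y, rfl⟩ := hr p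
      obtain ⟨x, hx⟩ := hs (q-1) (by omega) (-(Y.d q (q-1)).hom y)
      refine ⟨cinl f q (q-1) (by omega) x + cinr f q y,
        cone_ext f (q-1) (q-1-1) (by omega) ?_ ?_, by simp⟩
      · rw [cfst_d f q (q-1) (q-1-1) (by omega)]
        simp only [map_add, cfst_cinl, cfst_cinr, add_zero, map_zero]
        rw [neg_eq_zero]
        apply hinj
        rw [← comm_apply, hx, map_neg, dd_apply, map_zero, neg_zero]
      · rw [csnd_d f q (q-1) (by omega)]
        simp [hx]
    · intro c
      obtain ⟨x, hx⟩ := hs (q+1) (by omega) (csnd f (q+1) c)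
      rw [LinearMap.comp_apply, csnd_d f (q+1) q rfl, hk, ← hx, comm_apply, ← map_add]
      exact ⟨_, rfl⟩
    · intro c hc hrc
      obtain ⟨x, hx⟩ := (hk _).1 hrc
      exact key _ _ _ rfl (by omega) c x hx hc

end cone

section proj

variable {A : Type u} [Ring A]

lemma ker_fgp {M P : Type u} [AddCommGroup M] [Module A M] [AddCommGroup P] [Module A P]
    [Module.Finite A M] [Module.Projective A M] [Module.Projective A P] (g : M →ₗ[A] P)
    (hg : Function.Surjective g) :
    Module.Finite A (LinearMap.ker g) ∧ Module.Projective A (LinearMap.ker g) := by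
  obtain ⟨s, hs⟩ := Module.projective_lifting_property g LinearMap.id hg
  have hs' : ∀ x, g (s x) = x := fun x => congr($hs x)
  let t : M →ₗ[A] LinearMap.ker g :=
    LinearMap.codRestrict _ (LinearMap.id - s ∘ₗ g) (fun x => by simp [hs'])
  have ht : t ∘ₗ (LinearMap.ker g).subtype = LinearMap.id := by
    ext ⟨x, hx⟩
    have hx' : g x = 0 := hx
    simp [t, hx']
  have hts : Function.Surjective t := fun x => ⟨x, congr($ht x)⟩
  exact ⟨Module.Finite.of_surjective t hts, Module.Projective.of_split _ t ht⟩

lemma ker_d_fgp (C : ChainComplex (ModuleCat.{u} A) ℤ)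
    (hC : ∀ i, Module.Finite A (C.X i) ∧ Module.Projective A (C.X i))
    (hC0 : ∀ i, i < 0 → ∀ c : C.X i, c = 0) (m : ℤ)
    (hm : ∀ q, q ≤ m → IsZero (C.homology q)) (n : ℕ) :
    ∀ q : ℤ, q < n → q ≤ m + 1 → Module.Finite A (LinearMap.ker (C.d q (q-1)).hom) ∧
      Module.Projective A (LinearMap.ker (C.d q (q-1)).hom) := by
  induction n with
  | zero =>
    intro q hq _
    have : Subsingleton (LinearMap.ker (C.d q (q-1)).hom) :=
      ⟨fun a b => Subtype.ext ((hC0 q hq _).trans (hC0 q hq _).symm)⟩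
    exact ⟨inferInstance, inferInstance⟩
  | succ n ih =>
    intro q hq hqm
    obtain ⟨h1, h2⟩ := ih (q-1) (by push_cast at hq; omega) (by omega)
    obtain ⟨h3, h4⟩ := hC q
    let g : C.X q →ₗ[A] LinearMap.ker (C.d (q-1) (q-1-1)).hom :=
      LinearMap.codRestrict _ (C.d q (q-1)).hom (fun x => dd_apply C q (q-1) (q-1-1) x)
    have hg : Function.Surjective g := by
      rintro ⟨x, hx⟩
      obtain ⟨y, hy⟩ := (isZero_homology_iff C q (q-1) (q-1-1) (by omega) (by omega)).1
        (hm (q-1) (by omega)) x hx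
      exact ⟨y, Subtype.ext hy⟩
    have hk : LinearMap.ker (C.d q (q-1)).hom = LinearMap.ker g :=
      (LinearMap.ker_codRestrict _ _ _).symm
    rw [hk]
    exact ker_fgp g hg

end proj

section filt

variable {A : Type u} [Ring A] {X E C : ChainComplex (ModuleCat.{u} A) ℤ}

/-- The filtration of the relative complex. -/
def F (C : ChainComplex (ModuleCat.{u} A) ℤ) (m : ℤ) (n : ℕ) (i : ℤ) : Submodule A (C.X i) where
  carrier := {c | ((i ≤ m ∨ m + n < i) → c = 0) ∧ (i = m + 1 → (C.d i (i-1)).hom c = 0)}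
  add_mem' := by
    rintro a b ⟨h1, h2⟩ ⟨h3, h4⟩
    exact ⟨fun h => by rw [h1 h, h3 h, add_zero], fun h => by rw [map_add, h2 h, h4 h, add_zero]⟩
  zero_mem' := ⟨fun _ => rfl, fun _ => map_zero _⟩
  smul_mem' := by
    rintro a b ⟨h1, h2⟩
    exact ⟨fun h => by rw [h1 h, smul_zero], fun h => by rw [map_smul, h2 h, smul_zero]⟩

lemma mem_F {m : ℤ} {n : ℕ} {i : ℤ} {c : C.X i} : c ∈ F C m n i ↔
    ((i ≤ m ∨ m + n < i) → c = 0) ∧ (i = m + 1 → (C.d i (i-1)).hom c = 0) := Iff.rfl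

lemma F_d {m : ℤ} {n : ℕ} {i : ℤ} {c : C.X i} (hc : c ∈ F C m n i) (k : ℤ) :
    (C.d i k).hom c ∈ F C m n k := by
  by_cases hik : k + 1 = i
  · refine ⟨fun h => ?_, fun h => dd_apply C _ _ _ _⟩
    by_cases hi : i = m + 1
    · obtain rfl : k = i - 1 := by omega
      exact hc.2 hi
    · rw [hc.1 (by omega), map_zero]
  · rw [C.shape i k hik]
    exact Submodule.zero_mem _

lemma F_mono {m : ℤ} {n : ℕ} {i : ℤ} {c : C.X i} (hc : c ∈ F C m n i) : c ∈ F C m (n+1) i :=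
  ⟨fun h => hc.1 (by push_cast at h; omega), hc.2⟩

lemma F_anti {m : ℤ} {n : ℕ} {i : ℤ} {c : C.X i} (hc : c ∈ F C m (n+1) i) (hi : i ≠ m + n + 1) :
    c ∈ F C m n i :=
  ⟨fun h => hc.1 (by push_cast; omega), hc.2⟩

variable (π : E ⟶ C) (m : ℤ) (n : ℕ)

/-- The subcomplex of `E` lying over the filtration. -/
noncomputable def S : ChainComplex (ModuleCat.{u} A) ℤ where
  X i := ModuleCat.of A ((F C m n i).comap (π.f i).hom)
  d i j := ModuleCat.ofHom (LinearMap.restrict (E.d i j).hom (fun x hx => by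
    rw [Submodule.mem_comap] at hx ⊢
    rw [← comm_apply]
    exact F_d hx j))
  shape i j h := by
    ext x
    exact congr($(E.shape i j h).hom x.1)
  d_comp_d' i j k _ _ := by
    ext x
    exact dd_apply E i j k x.1

/-- inclusion of the subcomplex. -/
noncomputable def Sincl : S π m n ⟶ E where
  f _ := ModuleCat.ofHom (Submodule.subtype _)
  comm' _ _ _ := rfl

/-- lifting to the subcomplex. -/
noncomputable def Slift {K : ChainComplex (ModuleCat.{u} A) ℤ} (h : K ⟶ E)
    (hh : ∀ i x, (π.f i).hom ((h.f i).hom x) ∈ F C m n i) : K ⟶ S π m n where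
  f i := ModuleCat.ofHom (LinearMap.codRestrict _ (h.f i).hom (hh i))
  comm' i j _ := by
    ext x
    apply Subtype.ext
    exact comm_apply h i j x

lemma Slift_incl {K : ChainComplex (ModuleCat.{u} A) ℤ} (h : K ⟶ E)
    (hh : ∀ i x, (π.f i).hom ((h.f i).hom x) ∈ F C m n i) :
    Slift π m n h hh ≫ Sincl π m n = h := rfl

variable (ι : X ⟶ E)

/-- The tower. -/
noncomputable def Z (X : ChainComplex (ModuleCat.{u} A) ℤ) (π : E ⟶ C) (m : ℤ) :
    ℕ → ChainComplex (ModuleCat.{u} A) ℤ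
  | 0 => X
  | (n + 1) => S π m (n + 1)

/-- The map from the tower. -/
noncomputable def Zincl (ι : X ⟶ E) (π : E ⟶ C) (m : ℤ) : ∀ n, Z X π m n ⟶ E
  | 0 => ι
  | (n + 1) => Sincl π m (n + 1)

lemma Zincl_inj (hι : ∀ i, Function.Injective (ι.f i).hom) (n : ℕ) (i : ℤ) :
    Function.Injective ((Zincl ι π m n).f i).hom := by
  cases n with
  | zero => exact hι i
  | succ n => exact Subtype.val_injective

lemma Zincl_range (hex : ∀ i e, (π.f i).hom e = 0 ↔ ∃ x, (ι.f i).hom x = e) (n : ℕ) (i : ℤ)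
    (e : E.X i) : (∃ z, ((Zincl ι π m n).f i).hom z = e) ↔ (π.f i).hom e ∈ F C m n i := by
  cases n with
  | zero =>
    refine (hex i e).symm.trans ⟨fun h => ?_, fun h => h.1 (by push_cast; omega)⟩
    rw [h]
    exact Submodule.zero_mem _
  | succ n => exact ⟨fun ⟨z, hz⟩ => hz ▸ z.2, fun h => ⟨⟨e, h⟩, rfl⟩⟩

/-- The transition maps. -/
noncomputable def Zmap (hex : ∀ i e, (π.f i).hom e = 0 ↔ ∃ x, (ι.f i).hom x = e) (n : ℕ) :
    Z X π m n ⟶ Z X π m (n + 1) :=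
  Slift π m (n + 1) (Zincl ι π m n) (fun i x =>
    F_mono ((Zincl_range π m ι hex n i _).1 ⟨x, rfl⟩))

lemma Zmap_incl (hex : ∀ i e, (π.f i).hom e = 0 ↔ ∃ x, (ι.f i).hom x = e) (n : ℕ) :
    Zmap π m ι hex n ≫ Zincl ι π m (n + 1) = Zincl ι π m n := rfl

lemma compChain_incl (hex : ∀ i e, (π.f i).hom e = 0 ↔ ∃ x, (ι.f i).hom x = e) (n : ℕ) :
    compChain (Z X π m) (Zmap π m ι hex) n ≫ Zincl ι π m n = ι := by
  induction n with
  | zero => exact Category.id_comp _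
  | succ n ih => rw [compChain, Category.assoc, Zmap_incl, ih]

lemma main_abs (hι : ∀ i, Function.Injective (ι.f i).hom)
    (hπ : ∀ i, Function.Surjective (π.f i).hom)
    (hex : ∀ i e, (π.f i).hom e = 0 ↔ ∃ x, (ι.f i).hom x = e)
    (hC : ∀ i, Module.Finite A (C.X i) ∧ Module.Projective A (C.X i))
    (hCb : ∃ b : ℤ, ∀ i, (i < 0 ∨ b < i) → ∀ c : C.X i, c = 0)
    (hm : ∀ q, q ≤ m → IsZero (C.homology q)) :
    ∃ (N : ℕ) (Z : ℕ → ChainComplex (ModuleCat.{u} A) ℤ) (hZ0 : Z 0 = X)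
      (φ : ∀ j, Z j ⟶ Z (j + 1)) (g : Z N ⟶ E),
      QuasiIso g ∧
      eqToHom hZ0.symm ≫ compChain Z φ N ≫ g = ι ∧
      ∀ j : ℕ, j < N →
        (∀ q : ℤ, q ≠ m + (j : ℤ) + 1 → IsZero ((Cone (φ j)).homology q)) ∧
        Module.Finite A ((Cone (φ j)).homology (m + (j : ℤ) + 1)) ∧
        Module.Projective A ((Cone (φ j)).homology (m + (j : ℤ) + 1)) := by
  obtain ⟨b, hb⟩ := hCb
  let N : ℕ := (b - m).toNat
  have hN : b ≤ m + N := by omega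
  refine ⟨N, Z X π m, rfl, Zmap π m ι hex, Zincl ι π m N, ?_, ?_, ?_⟩
  · have hF : ∀ i, m < i → ∀ c : C.X i, (i = m + 1 → (C.d i (i-1)).hom c = 0) →
        c ∈ F C m N i := fun i hi c hc => ⟨fun h => hb i (by omega) c, hc⟩
    have hexact : ∀ i j k : ℤ, j + 1 = i → k + 1 = j → j ≤ m → ∀ e : E.X j,
        (C.d j k).hom ((π.f j).hom e) = 0 →
        ∃ y : E.X i, (π.f j).hom (e - (E.d i j).hom y) = 0 := by
      intro i j k hi hk hj e he
      obtain ⟨c, hc⟩ := (isZero_homology_iff C i j k hi hk).1 (hm j hj) _ he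
      obtain ⟨y, rfl⟩ := hπ i c
      exact ⟨y, by rw [map_sub, ← comm_apply, hc, sub_self]⟩
    apply quasiIso_of
    · intro i j k hi hk z hz l hl
      suffices h : ∃ e : E.X i, (π.f i).hom e ∈ F C m N i ∧
          (E.d i j).hom e = ((Zincl ι π m N).f j).hom z by
        obtain ⟨e, he, he'⟩ := h
        obtain ⟨y, rfl⟩ := (Zincl_range π m ι hex N i e).2 he
        refine ⟨y, Zincl_inj π m ι hι N j ?_⟩
        rw [← comm_apply, he']
      have hzF := (Zincl_range π m ι hex N j _).1 ⟨z, rfl⟩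
      have hd : j ≤ m → (C.d i j).hom ((π.f i).hom l) = 0 := fun hj => by
        rw [comm_apply, hl, hzF.1 (Or.inl hj)]
      by_cases hj : j < m
      · obtain ⟨y, hy⟩ := hexact (i+1) i j rfl hi (by omega) l (hd hj.le)
        refine ⟨l - (E.d (i+1) i).hom y, ?_, ?_⟩
        · rw [hy]; exact Submodule.zero_mem _
        · rw [map_sub, dd_apply, sub_zero, hl]
      · refine ⟨l, hF i (by omega) _ (fun h => ?_), hl⟩
        obtain rfl : j = i - 1 := by omega
        exact hd (by omega)
    · intro i j k hi hk l hl
      suffices h : ∃ (e : E.X j) (y : E.X i), (π.f j).hom e ∈ F C m N j ∧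
          e = l + (E.d i j).hom y by
        obtain ⟨e, y, he, he'⟩ := h
        obtain ⟨z, rfl⟩ := (Zincl_range π m ι hex N j e).2 he
        refine ⟨z, y, Zincl_inj π m ι hι N k ?_, he'⟩
        rw [← comm_apply, he', map_add, dd_apply, hl, add_zero, map_zero]
      by_cases hj : j ≤ m
      · obtain ⟨y, hy⟩ := hexact i j k hi hk hj l (by rw [comm_apply, hl, map_zero])
        refine ⟨l - (E.d i j).hom y, -y, ?_, ?_⟩
        · rw [hy]; exact Submodule.zero_mem _
        · rw [map_neg, sub_eq_add_neg]
      · refine ⟨l, 0, hF j (by omega) _ (fun h => ?_), by rw [map_zero, add_zero]⟩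
        obtain rfl : k = j - 1 := by omega
        rw [comm_apply, hl, map_zero]
  · rw [compChain_incl]
    exact Category.id_comp _
  · intro n _
    have hPf : Module.Finite A (F C m (n+1) (m+n+1)) ∧
        Module.Projective A (F C m (n+1) (m+n+1)) := by
      by_cases hn : n = 0
      · subst hn
        have e : F C m (0+1) (m+(0:ℕ)+1) =
            LinearMap.ker (C.d (m+(0:ℕ)+1) (m+(0:ℕ)+1-1)).hom := by
          ext c
          exact ⟨fun h => h.2 (by push_cast; omega),
            fun h => ⟨fun h' => by push_cast at h'; omega, fun _ => h⟩⟩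
        rw [e]
        exact ker_d_fgp C hC (fun i hi => hb i (Or.inl hi)) m hm (m+2).toNat _
          (by push_cast; omega) (by push_cast; omega)
      · have e : F C m (n+1) (m+n+1) = ⊤ := by
          ext c
          exact ⟨fun h => trivial, fun _ => ⟨fun h' => by push_cast at h'; omega,
            fun h => by omega⟩⟩
        rw [e]
        obtain ⟨h1, h2⟩ := hC (m+n+1)
        exact ⟨Module.Finite.equiv Submodule.topEquiv.symm,
          Module.Projective.of_equiv Submodule.topEquiv.symm⟩
    obtain ⟨hP1, hP2⟩ := hPf
    have hcomm : ∀ i z, ((Zincl ι π m (n+1)).f i).hom (((Zmap π m ι hex n).f i).hom z) =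
        ((Zincl ι π m n).f i).hom z := fun i z => rfl
    refine cone_conc (Zmap π m ι hex n) (m+n+1) ?_ ?_ (F C m (n+1) (m+n+1))
      (LinearMap.codRestrict _
        ((π.f (m+n+1)).hom ∘ₗ ((Zincl ι π m (n+1)).f (m+n+1)).hom)
        (fun z => (Zincl_range π m ι hex (n+1) _ _).1 ⟨z, rfl⟩)) ?_ ?_
    · intro i a b hab
      apply Zincl_inj π m ι hι n i
      rw [← hcomm, ← hcomm, hab]
    · intro i hi w
      obtain ⟨z, hz⟩ := (Zincl_range π m ι hex n i (((Zincl ι π m (n+1)).f i).hom w)).2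
        (F_anti ((Zincl_range π m ι hex (n+1) _ _).1 ⟨w, rfl⟩) hi)
      exact ⟨z, Zincl_inj π m ι hι (n+1) i ((hcomm i z).trans hz)⟩
    · rintro ⟨c, hc⟩
      obtain ⟨e, rfl⟩ := hπ _ c
      obtain ⟨z, rfl⟩ := (Zincl_range π m ι hex (n+1) _ _).2 hc
      exact ⟨z, rfl⟩
    · intro w
      have h1 : (π.f (m+n+1)).hom (((Zincl ι π m (n+1)).f (m+n+1)).hom w) = 0 ↔
          (π.f (m+n+1)).hom (((Zincl ι π m (n+1)).f (m+n+1)).hom w) ∈ F C m n (m+n+1) :=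
        ⟨fun h => by rw [h]; exact Submodule.zero_mem _, fun h => h.1 (by omega)⟩
      rw [← Zincl_range π m ι hex n] at h1
      rw [← Subtype.coe_inj]
      refine h1.trans ⟨?_, ?_⟩
      · rintro ⟨z, hz⟩
        exact ⟨z, Zincl_inj π m ι hι (n+1) _ ((hcomm _ z).trans hz)⟩
      · rintro ⟨z, rfl⟩
        exact ⟨z, rfl⟩

end filt

section cyl

variable {A : Type u} [Ring A] {X Y : ChainComplex (ModuleCat.{u} A) ℤ} (f : X ⟶ Y)

/-- The product of `Y` with the cone of the identity of `X`. -/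
noncomputable def EE (X Y : ChainComplex (ModuleCat.{u} A) ℤ) :
    ChainComplex (ModuleCat.{u} A) ℤ where
  X i := ModuleCat.of A (Y.X i × (Cone (𝟙 X)).X i)
  d i j := ModuleCat.ofHom (LinearMap.prodMap (Y.d i j).hom ((Cone (𝟙 X)).d i j).hom)
  shape i j h := by
    refine ModuleCat.hom_ext (LinearMap.ext fun x => ?_)
    exact Prod.ext congr($(Y.shape i j h).hom x.1) congr($((Cone (𝟙 X)).shape i j h).hom x.2)
  d_comp_d' i j k _ _ := by
    refine ModuleCat.hom_ext (LinearMap.ext fun x => ?_)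
    exact Prod.ext (dd_apply Y i j k x.1) (dd_apply (Cone (𝟙 X)) i j k x.2)

/-- The projection to `Y`. -/
noncomputable def Ep (X Y : ChainComplex (ModuleCat.{u} A) ℤ) : EE X Y ⟶ Y where
  f _ := ModuleCat.ofHom (LinearMap.fst A _ _)
  comm' _ _ _ := rfl

lemma cinr_d (i j : ℤ) (y : Y.X i) :
    ((Cone f).d i j).hom (cinr f i y) = cinr f j ((Y.d i j).hom y) :=
  congr($(HomologicalComplex.homotopyCofiber.inrX_d f i j).hom y)

/-- The inclusion of `X`. -/
noncomputable def Ei : X ⟶ EE X Y where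
  f i := ModuleCat.ofHom (LinearMap.prod (f.f i).hom (cinr (𝟙 X) i))
  comm' i j _ := by
    ext x
    exact Prod.ext (comm_apply f i j x) (cinr_d (𝟙 X) i j x)

/-- The degreewise map to the cone of `f`. -/
noncomputable def Epi0 (i : ℤ) : (EE X Y).X i →ₗ[A] (Cone f).X i :=
  cinr f i ∘ₗ LinearMap.fst A _ _ - (cinl f i (i-1) (by omega) ∘ₗ cfst (𝟙 X) i (i-1) (by omega) +
    cinr f i ∘ₗ (f.f i).hom ∘ₗ csnd (𝟙 X) i) ∘ₗ LinearMap.snd A _ _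

lemma cfst_Epi0 (i j : ℤ) (h : j + 1 = i) (y : Y.X i) (k : (Cone (𝟙 X)).X i) :
    cfst f i j h (Epi0 f i (y, k)) = - cfst (𝟙 X) i j h k := by
  obtain rfl : j = i - 1 := by omega
  change cfst f i (i-1) h (cinr f i y - (cinl f i (i-1) h (cfst (𝟙 X) i (i-1) h k) +
    cinr f i ((f.f i).hom (csnd (𝟙 X) i k)))) = _
  simp

lemma csnd_Epi0 (i : ℤ) (y : Y.X i) (k : (Cone (𝟙 X)).X i) :
    csnd f i (Epi0 f i (y, k)) = y - (f.f i).hom (csnd (𝟙 X) i k) := by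
  change csnd f i (cinr f i y - (cinl f i (i-1) (by omega) (cfst (𝟙 X) i (i-1) (by omega) k) +
    cinr f i ((f.f i).hom (csnd (𝟙 X) i k)))) = _
  simp

/-- The chain map to the cone of `f`. -/
noncomputable def Epi : EE X Y ⟶ Cone f where
  f i := ModuleCat.ofHom (Epi0 f i)
  comm' i j hij := by
    ext ⟨y, k⟩
    have hij' : j + 1 = i := hij
    change ((Cone f).d i j).hom (Epi0 f i (y, k)) =
      Epi0 f j ((Y.d i j).hom y, ((Cone (𝟙 X)).d i j).hom k)
    apply cone_ext f j (j-1) (by omega)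
    · rw [cfst_d f i j (j-1) hij', cfst_Epi0, cfst_Epi0, cfst_d (𝟙 X) i j (j-1) hij', map_neg]
    · rw [csnd_d f i j hij', csnd_Epi0, csnd_Epi0, cfst_Epi0, csnd_d (𝟙 X) i j hij',
        map_sub, comm_apply, map_add, map_neg]
      change _ = _ - ((f.f j).hom (cfst (𝟙 X) i j hij' k) + _)
      abel

lemma Ep_quasiIso : QuasiIso (Ep X Y) := by
  apply quasiIso_of
  · rintro i j k hi hk ⟨y, c⟩ hz l hl
    have hc : ((Cone (𝟙 X)).d j k).hom c = 0 := congrArg Prod.snd hz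
    refine ⟨(l, cinl (𝟙 X) i j hi (csnd (𝟙 X) j c)), Prod.ext hl ?_⟩
    change ((Cone (𝟙 X)).d i j).hom (cinl (𝟙 X) i j hi (csnd (𝟙 X) j c)) = c
    apply cone_ext (𝟙 X) j k hk
    · rw [cfst_d (𝟙 X) i j k hi hk, cfst_cinl]
      have := csnd_d (𝟙 X) j k hk c
      rw [hc, map_zero] at this
      exact (eq_neg_of_add_eq_zero_left this.symm).symm
    · rw [csnd_d (𝟙 X) i j hi, cfst_cinl, csnd_cinl, map_zero, add_zero]
      rfl
  · intro i j k hi hk l hl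
    exact ⟨(l, 0), 0, Prod.ext hl (map_zero ((Cone (𝟙 X)).d j k).hom), by rw [map_zero, add_zero]; rfl⟩

end cyl

end Aux

/-- An `m`-connected map `f : X ⟶ Y` of bounded nonnegatively graded chain
complexes of finitely generated projective `A`-modules factors as
`X = Z_m → Z_{m+1} → ⋯ → Z_n ≃ Y`, where `Z_n ⟶ Y` is a quasi-isomorphism and each
`cone(Z_{q−1} → Z_q)` has homology concentrated in degree `q`, where it is a finitely
generated projective `A`-module. -/
theorem stmt10 {A : Type u} [Ring A]
    (X Y : ChainComplex (ModuleCat.{u} A) ℤ)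
    (hXb : ∃ b : ℤ, ∀ i, (i < 0 ∨ b < i) → IsZero (X.X i))
    (hYb : ∃ b : ℤ, ∀ i, (i < 0 ∨ b < i) → IsZero (Y.X i))
    (hXfg : ∀ i, Module.Finite A (X.X i) ∧ Module.Projective A (X.X i))
    (hYfg : ∀ i, Module.Finite A (Y.X i) ∧ Module.Projective A (Y.X i))
    (m : ℤ) (f : X ⟶ Y)
    (hconn : ∀ q : ℤ, q ≤ m → IsZero ((Cone f).homology q)) :
    ∃ (N : ℕ) (Z : ℕ → ChainComplex (ModuleCat.{u} A) ℤ) (hZ0 : Z 0 = X)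
      (φ : ∀ j, Z j ⟶ Z (j + 1)) (g : Z N ⟶ Y),
      QuasiIso g ∧
      eqToHom hZ0.symm ≫ compChain Z φ N ≫ g = f ∧
      ∀ j : ℕ, j < N →
        (∀ q : ℤ, q ≠ m + (j : ℤ) + 1 → IsZero ((Cone (φ j)).homology q)) ∧
        Module.Finite A ((Cone (φ j)).homology (m + (j : ℤ) + 1)) ∧
        Module.Projective A ((Cone (φ j)).homology (m + (j : ℤ) + 1)) := by

  have hz : ∀ {M : ModuleCat.{u} A}, IsZero M → ∀ x : M, x = 0 := fun {M} h x =>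
    (ModuleCat.subsingleton_of_isZero h).elim x 0
  obtain ⟨b1, hb1⟩ := hXb
  obtain ⟨b2, hb2⟩ := hYb
  obtain ⟨N, Z, hZ0, φ, g, hg, hcomp, hrest⟩ := Aux.main_abs (Aux.Epi f) m (Aux.Ei f)
    (fun i x y h => by
      have h2 : Aux.cinr (𝟙 X) i x = Aux.cinr (𝟙 X) i y := congrArg Prod.snd h
      rw [← Aux.csnd_cinr (𝟙 X) i x, h2, Aux.csnd_cinr])
    (fun i c => by
      refine ⟨(Aux.csnd f i c, - Aux.cinl (𝟙 X) i (i-1) (by omega)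
        (Aux.cfst f i (i-1) (by omega) c)), ?_⟩
      apply Aux.cone_ext f i (i-1) (by omega)
      · refine (Aux.cfst_Epi0 f _ _ _ _ _).trans ?_
        simp
      · refine (Aux.csnd_Epi0 f _ _ _).trans ?_
        simp)
    (fun i e => by
      obtain ⟨y, k⟩ := e
      have h1 := Aux.cfst_Epi0 f i (i-1) (by omega) y k
      have h2 := Aux.csnd_Epi0 f i y k
      constructor
      · intro h
        have h' : Aux.Epi0 f i (y, k) = 0 := h
        rw [h', map_zero] at h1 h2
        refine ⟨Aux.csnd (𝟙 X) i k, Prod.ext (sub_eq_zero.1 h2.symm).symm ?_⟩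
        apply Aux.cone_ext (𝟙 X) i (i-1) (by omega)
        · refine (Aux.cfst_cinr _ _ _ _ _).trans ?_
          exact (neg_eq_zero.1 h1.symm).symm
        · exact Aux.csnd_cinr _ _ _
      · rintro ⟨x, hx⟩
        have hy : (f.f i).hom x = y := congrArg Prod.fst hx
        have hk : Aux.cinr (𝟙 X) i x = k := congrArg Prod.snd hx
        subst hy hk
        apply Aux.cone_ext f i (i-1) (by omega)
        · refine h1.trans ?_
          simp
        · refine h2.trans ?_
          simp)
    (fun i => by
      obtain ⟨h1, h2⟩ := hXfg (i-1)
      obtain ⟨h3, h4⟩ := hYfg i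
      let e := Aux.coneEquiv f i (i-1) (by omega)
      exact ⟨Module.Finite.equiv e, Module.Projective.of_equiv e⟩)
    ⟨max (b1+1) b2, fun i hi c => by
      apply Aux.cone_ext f i (i-1) (by omega)
      · rw [map_zero]
        exact hz (hb1 (i-1) (by omega)) _
      · rw [map_zero]
        exact hz (hb2 i (by omega)) _⟩ hconn
  refine ⟨N, Z, hZ0, φ, g ≫ Aux.Ep X Y, ?_, ?_, hrest⟩
  · have := Aux.Ep_quasiIso (X := X) (Y := Y)
    infer_instance
  · rw [← Category.assoc, ← Category.assoc, Category.assoc (eqToHom _), hcomp]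
    rfl
end

section
/- Let A be a ring and X a bounded chain complex of A[t]-modules each of whose terms is finitely generated projective as an A-module. Then there exist a bounded chain complex C of finitely generated projective A[t]-modules and an A[t]-linear quasi-isomorphism C → X. (Every A-perfect complex of A[t]-modules is A[t]-perfect; the quasi-isomorphism can be taken to be the collapse of the two-term complex X[t] →^{t−f} X[t] onto X.) -/
open CategoryTheory Limits

universe u

namespace PolyRes

open Polynomial

/-- `M[t]` for an `A[t]`-module `M`, where `A` acts on the coefficients and `t` by shifting. -/
def PM (A : Type u) (M : Type u) [Ring A] [AddCommGroup M] [Module A[X] M] : Type u := ℕ →₀ M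

section

variable {A : Type u} [Ring A] {M N : Type u} [AddCommGroup M] [Module A[X] M]
  [AddCommGroup N] [Module A[X] N]

noncomputable instance : AddCommGroup (PM A M) := inferInstanceAs (AddCommGroup (ℕ →₀ M))

/-- the monomial `m t^n` -/
noncomputable def mono (A : Type u) [Ring A] {M : Type u} [AddCommGroup M] [Module A[X] M] (n : ℕ) :
    M →+ PM A M := Finsupp.singleAddHom n

/-- additive maps out of `M[t]` -/
noncomputable def lift {B : Type u} [AddCommGroup B] (f : ℕ → M →+ B) : PM A M →+ B :=
  Finsupp.liftAddHom f

@[simp] lemma lift_mono {B : Type u} [AddCommGroup B] (f : ℕ → M →+ B) (n : ℕ) (m : M) :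
    lift (A := A) f (mono A n m) = f n m :=
  Finsupp.liftAddHom_apply_single f n m

lemma pm_ext {B : Type u} [AddCommGroup B] {f g : PM A M →+ B}
    (h : ∀ n m, f (mono A n m) = g (mono A n m)) : f = g :=
  Finsupp.addHom_ext h

lemma pm_induction {motive : PM A M → Prop} (x : PM A M) (h0 : motive 0)
    (hadd : ∀ x y, motive x → motive y → motive (x + y))
    (hm : ∀ n m, motive (mono A n m)) : motive x :=
  Finsupp.induction_linear x h0 hadd hm

/-- multiplication by `t` -/
noncomputable def shift : AddMonoid.End (PM A M) := lift (fun n => mono A (n + 1))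

/-- multiplication by scalars -/
noncomputable def scal : A →+* AddMonoid.End (PM A M) :=
  (Module.toAddMonoidEnd A[X] (ℕ →₀ M)).comp (C : A →+* A[X])

lemma scal_mono (a : A) (n : ℕ) (m : M) :
    scal a (mono A n m) = mono A n ((C a : A[X]) • m) :=
  Finsupp.smul_single (C a : A[X]) n m

lemma shift_mono (n : ℕ) (m : M) : shift (mono A n m) = mono A (n + 1) m :=
  lift_mono _ _ _

/-- the action -/
noncomputable def act : A[X] →+* AddMonoid.End (PM A M) :=
  eval₂RingHom' scal shift (fun a => by
    apply pm_ext
    intro n m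
    change scal a (shift _) = shift (scal a _)
    rw [shift_mono, scal_mono, scal_mono, shift_mono])

noncomputable instance : Module A[X] (PM A M) := Module.compHom (PM A M) (act (A := A) (M := M))

lemma C_smul_mono (a : A) (n : ℕ) (m : M) :
    (C a : A[X]) • mono A n m = mono A n ((C a : A[X]) • m) := by
  change act (C a) (mono A n m) = _
  rw [← scal_mono]
  congr 1
  exact eval₂_C _ _

lemma X_smul_mono (n : ℕ) (m : M) :
    (X : A[X]) • mono A n m = mono A (n + 1) m := by
  change act X (mono A n m) = _
  rw [← shift_mono]
  congr 1
  exact eval₂_X _ _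

/-- linearity may be tested on scalars and on `t` -/
def mkLin {P Q : Type u} [AddCommGroup P] [Module A[X] P] [AddCommGroup Q] [Module A[X] Q]
    (f : P →+ Q) (hC : ∀ (a : A) x, f ((C a : A[X]) • x) = (C a : A[X]) • f x)
    (hX : ∀ x, f ((X : A[X]) • x) = (X : A[X]) • f x) : P →ₗ[A[X]] Q where
  toFun := f
  map_add' := f.map_add
  map_smul' p := by
    dsimp only [RingHom.id_apply]
    induction p using Polynomial.induction_on with
    | C a => exact hC a
    | add p q hp hq => intro x; rw [add_smul, map_add, hp, hq, add_smul]
    | monomial n a ih =>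
      intro x
      rw [pow_succ, ← mul_assoc, mul_smul, ih, hX, ← mul_smul]

/-- linear maps out of `M[t]` -/
noncomputable def liftLin (f : ℕ → M →+ N)
    (hC : ∀ n (a : A) m, f n ((C a : A[X]) • m) = (C a : A[X]) • f n m)
    (hX : ∀ n m, f (n + 1) m = (X : A[X]) • f n m) : PM A M →ₗ[A[X]] N :=
  mkLin (lift f)
    (fun a x => by
      induction x using pm_induction with
      | h0 => simp
      | hadd x y hx hy => simp only [smul_add, map_add, hx, hy]
      | hm n m => rw [C_smul_mono, lift_mono, lift_mono, hC])
    (fun x => by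
      induction x using pm_induction with
      | h0 => simp
      | hadd x y hx hy => simp only [smul_add, map_add, hx, hy]
      | hm n m => rw [X_smul_mono, lift_mono, lift_mono, hX])

@[simp] lemma liftLin_mono (f : ℕ → M →+ N) (hC) (hX) (n : ℕ) (m : M) :
    liftLin (A := A) f hC hX (mono A n m) = f n m := lift_mono _ _ _

lemma lin_ext {f g : PM A M →ₗ[A[X]] N} (h : ∀ n m, f (mono A n m) = g (mono A n m)) : f = g := by
  ext x
  exact DFunLike.congr_fun (pm_ext (f := f.toAddMonoidHom) (g := g.toAddMonoidHom) h) x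

/-- functoriality -/
noncomputable def mapLin (f : M →ₗ[A[X]] N) : PM A M →ₗ[A[X]] PM A N :=
  liftLin (fun n => (mono A n).comp f.toAddMonoidHom)
    (fun n a m => by simp [C_smul_mono]) (fun n m => by simp [X_smul_mono])

@[simp] lemma mapLin_mono (f : M →ₗ[A[X]] N) (n : ℕ) (m : M) :
    mapLin f (mono A n m) = mono A n (f m) := liftLin_mono _ _ _ _ _

lemma X_C_smul (a : A) (m : M) : (X : A[X]) • (C a : A[X]) • m = (C a : A[X]) • (X : A[X]) • m := by
  rw [← mul_smul, ← mul_smul, X_mul_C]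

lemma X_pow_C_smul (n : ℕ) (a : A) (m : M) :
    (X ^ n : A[X]) • (C a : A[X]) • m = (C a : A[X]) • (X ^ n : A[X]) • m := by
  rw [← mul_smul, ← mul_smul, X_pow_mul_C]

variable (A M) in
/-- the map `t - f` -/
noncomputable def al : PM A M →ₗ[A[X]] PM A M :=
  liftLin (fun n => mono A (n + 1) - (mono A n).comp (DistribSMul.toAddMonoidHom M (X : A[X])))
    (fun n a m => by simp [C_smul_mono, smul_sub, X_C_smul])
    (fun n m => by simp [X_smul_mono, smul_sub])

@[simp] lemma al_mono (n : ℕ) (m : M) :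
    al A M (mono A n m) = mono A (n + 1) m - mono A n ((X : A[X]) • m) := liftLin_mono _ _ _ _ _

variable (A M) in
/-- the augmentation -/
noncomputable def ep : PM A M →ₗ[A[X]] M :=
  liftLin (fun n => DistribSMul.toAddMonoidHom M (X ^ n : A[X]))
    (fun n a m => by simp [X_pow_C_smul])
    (fun n m => by simp [pow_succ', mul_smul])

@[simp] lemma ep_mono (n : ℕ) (m : M) :
    ep A M (mono A n m) = (X ^ n : A[X]) • m := liftLin_mono _ _ _ _ _

lemma ep_al : ep A M ∘ₗ al A M = 0 := by
  apply lin_ext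
  intro n m
  simp [pow_succ, mul_smul]

lemma ep_surj : Function.Surjective (ep A M) := fun m => ⟨mono A 0 m, by simp⟩

lemma mono_sub (n : ℕ) (m : M) : mono A n m - mono A 0 ((X ^ n : A[X]) • m) ∈ (al A M).range := by
  induction n generalizing m with
  | zero => simp
  | succ n ih =>
    have h := Submodule.add_mem _ (LinearMap.mem_range_self (al A M) (mono A n m))
      (ih ((X : A[X]) • m))
    rw [al_mono, ← mul_smul, ← pow_succ] at h
    simpa using h

lemma sub_mem (x : PM A M) : x - mono A 0 (ep A M x) ∈ (al A M).range := by
  induction x using pm_induction with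
  | h0 => simp
  | hadd x y hx hy =>
    have := Submodule.add_mem _ hx hy
    rw [map_add, map_add, add_sub_add_comm]
    exact this
  | hm n m => simpa using mono_sub n m

lemma al_ep_exact : Function.Exact (al A M) (ep A M) := by
  intro x
  constructor
  · intro hx
    have := sub_mem x
    rw [hx] at this
    simpa using this
  · rintro ⟨y, rfl⟩
    exact LinearMap.congr_fun ep_al y

/-- coefficients -/
noncomputable def coef (n : ℕ) : PM A M →+ M := Finsupp.applyAddHom n

lemma coef_mono (n k : ℕ) (m : M) : coef k (mono A n m) = if n = k then m else 0 :=
  Finsupp.single_apply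

lemma coef_al (n : ℕ) (x : PM A M) :
    coef (n + 1) (al A M x) = coef n x - (X : A[X]) • coef (n + 1) x := by
  induction x using pm_induction with
  | h0 => simp
  | hadd x y hx hy => simp only [map_add, hx, hy, smul_add]; abel
  | hm k m =>
    rw [al_mono, map_sub, coef_mono, coef_mono, coef_mono, coef_mono]
    simp only [add_left_inj, smul_ite, smul_zero]

lemma al_inj : Function.Injective (al A M) := by
  rw [injective_iff_map_eq_zero]
  intro x hx
  have h1 : ∀ n, coef n x = (X : A[X]) • coef (n + 1) x := by
    intro n
    have := coef_al n x
    rw [hx, map_zero] at this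
    exact (sub_eq_zero.mp this.symm)
  have h2 : ∀ k n, coef n x = (X ^ k : A[X]) • coef (n + k) x := by
    intro k
    induction k with
    | zero => simp
    | succ k ih =>
      intro n
      rw [ih n, h1 (n + k), ← mul_smul, ← pow_succ, add_assoc]
  obtain ⟨K, hK⟩ : ∃ K, ∀ n, K ≤ n → coef n x = 0 := by
    clear h2 h1 hx
    induction x using pm_induction with
    | h0 => exact ⟨0, by simp⟩
    | hadd x y hx hy =>
      obtain ⟨K, hK⟩ := hx
      obtain ⟨L, hL⟩ := hy
      exact ⟨K + L, fun n hn => by rw [map_add, hK n (by omega), hL n (by omega), add_zero]⟩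
    | hm n m =>
      exact ⟨n + 1, fun k hk => by rw [coef_mono, if_neg (by omega)]⟩
  refine Finsupp.ext fun n => ?_
  change coef n x = 0
  rw [h2 K n, hK _ (by omega), smul_zero]

lemma mono_eq (n : ℕ) (m : M) : mono A n m = (X ^ n : A[X]) • mono A 0 m := by
  induction n with
  | zero => simp
  | succ n ih => rw [← X_smul_mono, ih, ← mul_smul, ← pow_succ']

lemma pm_finite [Module A M] (h : ∀ (a : A) (m : M), a • m = (C a : A[X]) • m)
    [hf : Module.Finite A M] : Module.Finite A[X] (PM A M) := by
  classical
  obtain ⟨S, hS⟩ := hf.fg_top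
  refine ⟨⟨S.image (mono A 0), ?_⟩⟩
  rw [eq_top_iff]
  have h0 : ∀ m : M, mono A 0 m ∈ Submodule.span A[X] (S.image (mono A 0) : Set (PM A M)) := by
    intro m
    have hm : m ∈ Submodule.span A (S : Set M) := by rw [hS]; trivial
    induction hm using Submodule.span_induction with
    | mem x hx => exact Submodule.subset_span (by simpa using ⟨x, hx, rfl⟩)
    | zero => simp
    | add x y _ _ hx hy => rw [map_add]; exact Submodule.add_mem _ hx hy
    | smul a x _ hx => rw [h, ← C_smul_mono]; exact Submodule.smul_mem _ _ hx
  intro x _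
  refine pm_induction x (Submodule.zero_mem _) (fun x y hx hy => Submodule.add_mem _ hx hy) ?_
  intro n m
  rw [mono_eq]
  exact Submodule.smul_mem _ _ (h0 m)

lemma pm_projective [Module A M] (h : ∀ (a : A) (m : M), a • m = (C a : A[X]) • m)
    [Module.Projective A M] : Module.Projective A[X] (PM A M) := by
  refine Module.Projective.of_lifting_property'' fun f hf => ?_
  let _ : Module A (PM A M) := Module.compHom (PM A M) (C : A →+* A[X])
  let _ : Module A (PM A M →₀ A[X]) := Module.compHom _ (C : A →+* A[X])
  let f' : (PM A M →₀ A[X]) →ₗ[A] PM A M :=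
    { toFun := f, map_add' := f.map_add, map_smul' := fun a x => f.map_smul (C a : A[X]) x }
  let i : M →ₗ[A] PM A M :=
    { toFun := mono A 0, map_add' := map_add _,
      map_smul' := fun a x => by rw [h, ← C_smul_mono]; rfl }
  obtain ⟨g, hg⟩ := Module.projective_lifting_property f' i hf
  refine ⟨liftLin (fun n => (DistribSMul.toAddMonoidHom _ (X ^ n : A[X])).comp g.toAddMonoidHom)
    ?_ ?_, ?_⟩
  · intro n a m
    change (X ^ n : A[X]) • g ((C a : A[X]) • m) = (C a : A[X]) • (X ^ n : A[X]) • g m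
    rw [← h, g.map_smul, ← X_pow_C_smul]
    rfl
  · intro n m
    change (X ^ (n + 1) : A[X]) • g m = (X : A[X]) • (X ^ n : A[X]) • g m
    rw [pow_succ', mul_smul]
  · apply lin_ext
    intro n m
    rw [LinearMap.comp_apply, liftLin_mono]
    change f ((X ^ n : A[X]) • g m) = mono A n m
    rw [f.map_smul, mono_eq]
    congr 1
    exact LinearMap.congr_fun hg m

end

section

variable (A : Type u) [Ring A]

/-- the functor `M ↦ M[t]` -/
noncomputable def F : ModuleCat.{u} A[X] ⥤ ModuleCat.{u} A[X] where
  obj M := ModuleCat.of A[X] (PM A M)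
  map f := ModuleCat.ofHom (mapLin f.hom)
  map_id M := by
    ext1
    apply lin_ext
    intro n m
    simp
  map_comp f g := by
    ext1
    apply lin_ext
    intro n m
    simp

instance : (F A).Additive where
  map_add {M N f g} := by
    ext1
    apply lin_ext
    intro n m
    change mapLin (f.hom + g.hom) (mono A n m) = mapLin f.hom (mono A n m) + mapLin g.hom (mono A n m)
    simp

/-- `t - f` as a natural transformation -/
noncomputable def alT : F A ⟶ F A where
  app M := ModuleCat.ofHom (al A M)
  naturality M N f := by
    ext1
    apply lin_ext
    intro n m
    change al A N (mapLin f.hom (mono A n m)) = mapLin f.hom (al A M (mono A n m))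
    simp

/-- the augmentation as a natural transformation -/
noncomputable def epT : F A ⟶ 𝟭 _ where
  app M := ModuleCat.ofHom (ep A M)
  naturality M N f := by
    ext1
    apply lin_ext
    intro n m
    simp [F]

lemma alT_epT : alT A ≫ epT A = 0 := by
  ext1; ext1 M
  ext1
  exact ep_al

/-- the short complex of complexes -/
noncomputable def S (Y : CochainComplex (ModuleCat.{u} A[X]) ℤ) :
    ShortComplex (CochainComplex (ModuleCat.{u} A[X]) ℤ) where
  X₁ := ((F A).mapHomologicalComplex _).obj Y
  X₂ := ((F A).mapHomologicalComplex _).obj Y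
  X₃ := Y
  f := (NatTrans.mapHomologicalComplex (alT A) _).app Y
  g := { f := fun i => (epT A).app (Y.X i)
         comm' := fun i j _ => ((epT A).naturality (Y.d i j)).symm }
  zero := by
    ext1 i
    exact NatTrans.congr_app (alT_epT A) (Y.X i)

lemma S_exact (Y : CochainComplex (ModuleCat.{u} A[X]) ℤ) : (S A Y).ShortExact := by
  apply HomologicalComplex.shortExact_of_degreewise_shortExact
  intro i
  exact ModuleCat.shortComplex_shortExact _ (al_ep_exact (A := A) (M := Y.X i))
    (al_inj (A := A) (M := Y.X i)) (ep_surj (A := A) (M := Y.X i))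

lemma quasiIso_restr {K L : CochainComplex (ModuleCat.{u} A[X]) ℤ} (φ : K ⟶ L) (h : QuasiIso φ) :
    QuasiIso (HomologicalComplex.restrictionMap φ ComplexShape.embeddingDownIntUpInt) where
  quasiIsoAt i := by
    rw [quasiIsoAt_iff' _ (i + 1) i (i - 1) (by simp) (by simp)]
    have := (quasiIsoAt_iff' φ (-(i + 1)) (-i) (-(i - 1)) (by simp; ring) (by simp; ring)).mp
      (h.quasiIsoAt _)
    exact this

end

end PolyRes

/-- If `X` is a bounded chain complex of `A[t]`-modules each of whose terms
is finitely generated projective as an `A`-module, then there is a bounded chain complex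
`C` of finitely generated projective `A[t]`-modules together with an `A[t]`-linear
quasi-isomorphism `C ⟶ X`. -/
theorem stmt15 (A : Type u) [Ring A]
    (X : ChainComplex (ModuleCat.{u} (Polynomial A)) ℤ)
    (hbdd : ∃ a b : ℤ, ∀ i, (i < a ∨ b < i) → IsZero (X.X i))
    (hfgA : ∀ i,
      Module.Finite A
        ((ModuleCat.restrictScalars.{u} (Polynomial.C : A →+* Polynomial A)).obj (X.X i)) ∧
      Module.Projective A
        ((ModuleCat.restrictScalars.{u} (Polynomial.C : A →+* Polynomial A)).obj (X.X i))) :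
    ∃ C : ChainComplex (ModuleCat.{u} (Polynomial A)) ℤ,
      (∃ a b : ℤ, ∀ i, (i < a ∨ b < i) → IsZero (C.X i)) ∧
      (∀ i, Module.Finite (Polynomial A) (C.X i) ∧
        Module.Projective (Polynomial A) (C.X i)) ∧
      ∃ φ : C ⟶ X, QuasiIso φ := by
  let Y : CochainComplex (ModuleCat.{u} (Polynomial A)) ℤ :=
    X.restriction ComplexShape.embeddingUpIntDownInt
  let K := CochainComplex.mappingCone (PolyRes.S A Y).f
  have hF : ∀ i, Module.Finite (Polynomial A) (PolyRes.PM A (X.X i)) ∧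
      Module.Projective (Polynomial A) (PolyRes.PM A (X.X i)) := by
    intro i
    obtain ⟨h1, h2⟩ := hfgA i
    let _ : Module A (X.X i) := Module.compHom _ (Polynomial.C : A →+* Polynomial A)
    have : Module.Finite A (X.X i) := h1
    have : Module.Projective A (X.X i) := h2
    exact ⟨PolyRes.pm_finite (fun _ _ => rfl), PolyRes.pm_projective (fun _ _ => rfl)⟩
  have hZ : ∀ i, IsZero (X.X i) → IsZero (((PolyRes.F A).mapHomologicalComplex _).obj Y |>.X (-i)) := by
    intro i hi
    refine (PolyRes.F A).map_isZero ?_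
    change IsZero (X.X (- -i))
    rwa [neg_neg]
  refine ⟨K.restriction ComplexShape.embeddingDownIntUpInt, ?_, ?_, ?_⟩
  · obtain ⟨a, b, h⟩ := hbdd
    refine ⟨a, b + 1, fun i hi => ?_⟩
    change IsZero (K.X (-i))
    rw [CochainComplex.mappingCone.isZero_X_iff]
    refine ⟨?_, hZ i (h i (by omega))⟩
    have := hZ (i - 1) (h _ (by omega))
    rwa [show -(i - 1) = -i + 1 by ring] at this
  · intro i
    let e : K.X (-i) ≅ _ :=
      HomologicalComplex.homotopyCofiber.XIsoBiprod (PolyRes.S A Y).f (-i) (-i + 1) rfl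
    let e' := (e ≪≫ ModuleCat.biprodIsoProd _ _).toLinearEquiv
    obtain ⟨h1, h2⟩ := hF (- (-i + 1))
    obtain ⟨h3, h4⟩ := hF (- -i)
    have : Module.Finite (Polynomial A) ((PolyRes.S A Y).X₁.X (-i + 1)) := h1
    have : Module.Projective (Polynomial A) ((PolyRes.S A Y).X₁.X (-i + 1)) := h2
    have : Module.Finite (Polynomial A) ((PolyRes.S A Y).X₂.X (-i)) := h3
    have : Module.Projective (Polynomial A) ((PolyRes.S A Y).X₂.X (-i)) := h4
    exact ⟨Module.Finite.equiv e'.symm, Module.Projective.of_equiv e'.symm⟩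
  · have h := PolyRes.quasiIso_restr A _
      (CochainComplex.mappingCone.quasiIso_descShortComplex (PolyRes.S_exact A Y))
    let e : Y.restriction ComplexShape.embeddingDownIntUpInt ≅ X :=
      ((ChainComplex.cochainComplexEquivalence (ModuleCat.{u} (Polynomial A))).unitIso.app X).symm
    exact ⟨HomologicalComplex.restrictionMap
      (CochainComplex.mappingCone.descShortComplex (PolyRes.S A Y)) _ ≫ e.hom, @quasiIso_comp _ _ _ _ _ _ _ _ _ e.hom _ _ _ h inferInstance⟩
end
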